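/- arXiv:1807.10098 — 2 statements merged into one kernel-verified Lean document; each statement's English description precedes it below -/
import Mathlib

section
/- (Asymptotic part of Theorem 1.) As γ → +∞ we have: β_γ → 0; u_γ ⇀ u_∞ := √(l/λ₁) v₁ weakly in H¹₀(Ω), and u_∞ ≢ 0; and the quantification ∫_Ω |∇u_γ|² dy = 4π + l + o(1) holds. -/
open Real Set Filter MeasureTheory Topology

noncomputable section

/-- The radial Laplacian with the sign convention Δ = −div(∇·):
for a radial C² function, (Δu)(r) = −u''(r) − u'(r)/r. -/
def radLap (u : ℝ → ℝ) (r : ℝ) : ℝ := -(deriv (deriv u) r) - deriv u r / r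

/-- `EigenCtx lam1 v1` : λ₁ > 0 is the first radial Dirichlet eigenvalue of Δ = −div∇
on the unit disk, with radial eigenfunction v₁: v₁ smooth on [0,1], Δv₁ = λ₁v₁ in Ω,
v₁ > 0 in Ω, v₁(1) = 0 and ∫_Ω v₁² dy = ∫₀¹ v₁(r)² 2πr dr = 1. -/
def EigenCtx (lam1 : ℝ) (v1 : ℝ → ℝ) : Prop :=
  0 < lam1 ∧ ContDiffOn ℝ (⊤ : ℕ∞) v1 (Set.Icc 0 1) ∧
    (∀ r ∈ Set.Ioo (0:ℝ) 1, radLap v1 r = lam1 * v1 r) ∧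
    (∀ r ∈ Set.Ico (0:ℝ) 1, 0 < v1 r) ∧ v1 1 = 0 ∧
    (∫ r in Set.Ioo (0:ℝ) 1, (v1 r) ^ 2 * (2 * π * r)) = 1

/-- `IsRadSol lam beta gam u` : u is a smooth radial function on the closed unit disk,
positive in the open disk, vanishing on the boundary, with central value γ, solving
Δu = λu + βu e^{u²} in Ω (radially). -/
def IsRadSol (lam beta gam : ℝ) (u : ℝ → ℝ) : Prop :=
  ContDiffOn ℝ (⊤ : ℕ∞) u (Set.Icc 0 1) ∧
    (∀ r ∈ Set.Ioo (0:ℝ) 1,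
      radLap u r = lam * u r + beta * u r * Real.exp ((u r) ^ 2)) ∧
    (∀ r ∈ Set.Ico (0:ℝ) 1, 0 < u r) ∧ u 1 = 0 ∧ u 0 = gam

/-- λ̄_γ = λ₁ − ε_γ with ε_γ = (4π v₁(0)/γ)√(λ₁/l). -/
def lamBar (lam1 v10 l γ : ℝ) : ℝ := lam1 - 4 * π * v10 / γ * Real.sqrt (lam1 / l)

/-- The family (β_γ, u_γ) of Theorem 1: for every γ > 0 with λ̄_γ > 0, β_γ > 0 and u_γ
is a smooth positive radial solution of Δu = λ̄_γ u + β_γ u e^{u²} with u_γ(0) = γ. -/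
def GoodFamily (lam1 : ℝ) (v1 : ℝ → ℝ) (l : ℝ) (β : ℝ → ℝ) (u : ℝ → ℝ → ℝ) : Prop :=
  ∀ γ : ℝ, 0 < γ → 0 < lamBar lam1 (v1 0) l γ →
    0 < β γ ∧ IsRadSol (lamBar lam1 (v1 0) l γ) (β γ) γ (u γ)

/-- Dirichlet energy ∫_Ω |∇u|² dy of a radial function, = ∫₀¹ u'(r)² 2πr dr. -/
def dirEnergy (u : ℝ → ℝ) : ℝ := ∫ r in Set.Ioo (0:ℝ) 1, (deriv u r) ^ 2 * (2 * π * r)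

/-- L² norm ‖u‖_{L²(Ω)} of a radial function. -/
def l2norm (u : ℝ → ℝ) : ℝ := Real.sqrt (∫ r in Set.Ioo (0:ℝ) 1, (u r) ^ 2 * (2 * π * r))

/-! ### Monotonicity helpers -/

theorem le_of_hasDerivAt_nonneg {f f' : ℝ → ℝ} {a b : ℝ} (hab : a ≤ b)
    (hf : ContinuousOn f (Icc a b)) (hd : ∀ x ∈ Ioo a b, HasDerivAt f (f' x) x)
    (h : ∀ x ∈ Ioo a b, 0 ≤ f' x) : f a ≤ f b := by
  have hm : MonotoneOn f (Icc a b) := by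
    refine monotoneOn_of_deriv_nonneg (convex_Icc a b) hf ?_ ?_
    · rw [interior_Icc]
      exact fun x hx => (hd x hx).differentiableAt.differentiableWithinAt
    · rw [interior_Icc]
      intro x hx
      rw [(hd x hx).deriv]
      exact h x hx
  exact hm (left_mem_Icc.2 hab) (right_mem_Icc.2 hab) hab

theorem sub_le_sub_of_hasDerivAt_le {f g f' g' : ℝ → ℝ} {a b : ℝ} (hab : a ≤ b)
    (hf : ContinuousOn f (Icc a b)) (hg : ContinuousOn g (Icc a b))
    (hdf : ∀ x ∈ Ioo a b, HasDerivAt f (f' x) x) (hdg : ∀ x ∈ Ioo a b, HasDerivAt g (g' x) x)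
    (h : ∀ x ∈ Ioo a b, f' x ≤ g' x) : f b - f a ≤ g b - g a := by
  have := le_of_hasDerivAt_nonneg (f := fun x => g x - f x) hab (hg.sub hf)
    (fun x hx => (hdg x hx).sub (hdf x hx)) (fun x hx => sub_nonneg.2 (h x hx))
  linarith

/-! ### Radial solutions in first-order form -/

/-- The nonlinearity `x ↦ λ x + β x exp(x²)`. -/
def src (lam bet x : ℝ) : ℝ := lam * x + bet * x * exp (x ^ 2)

/-- The outward flux `-r u'(r)` of a radial function with derivative `p`. -/
def flux (p : ℝ → ℝ) (r : ℝ) : ℝ := -(r * p r)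

/-- A positive radial solution on the unit disk, with derivative `p` continuous up to the ends. -/
structure RadODE (lam bet : ℝ) (u p : ℝ → ℝ) : Prop where
  lam_pos : 0 < lam
  bet_nonneg : 0 ≤ bet
  cont : ContinuousOn u (Icc 0 1)
  cont_deriv : ContinuousOn p (Icc 0 1)
  hasDerivAt : ∀ r ∈ Ioo (0:ℝ) 1, HasDerivAt u (p r) r
  hasDerivAt_flux : ∀ r ∈ Ioo (0:ℝ) 1, HasDerivAt (flux p) (r * src lam bet (u r)) r
  pos : ∀ r ∈ Ico (0:ℝ) 1, 0 < u r
  bdry : u 1 = 0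

theorem RadODE.of_radLap {lam bet : ℝ} {u : ℝ → ℝ} (hlam : 0 < lam) (hbet : 0 ≤ bet)
    (hu : ContDiffOn ℝ (⊤ : ℕ∞) u (Icc 0 1))
    (hode : ∀ r ∈ Ioo (0:ℝ) 1, radLap u r = src lam bet (u r))
    (hpos : ∀ r ∈ Ico (0:ℝ) 1, 0 < u r) (hb : u 1 = 0) :
    RadODE lam bet u (derivWithin u (Icc 0 1)) := by
  have huniq : UniqueDiffOn ℝ (Icc (0:ℝ) 1) := uniqueDiffOn_Icc one_pos
  have hp : ContDiffOn ℝ (⊤ : ℕ∞) (derivWithin u (Icc 0 1)) (Icc 0 1) :=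
    hu.derivWithin huniq (by simp)
  have hd : ∀ r ∈ Ioo (0:ℝ) 1, HasDerivAt u (derivWithin u (Icc 0 1) r) r := fun r hr =>
    ((hu.differentiableOn (by simp)) r (Ioo_subset_Icc_self hr)).hasDerivWithinAt.hasDerivAt
      (Icc_mem_nhds hr.1 hr.2)
  refine ⟨hlam, hbet, hu.continuousOn, hp.continuousOn, hd, ?_, hpos, hb⟩
  intro r hr
  have h2 : HasDerivAt (derivWithin u (Icc 0 1)) (deriv (deriv u) r) r := by
    have h3 := ((hp.differentiableOn (by simp)) r
      (Ioo_subset_Icc_self hr)).differentiableAt (Icc_mem_nhds hr.1 hr.2)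
    have h4 : deriv (deriv u) r = deriv (derivWithin u (Icc 0 1)) r := by
      apply Filter.EventuallyEq.deriv_eq
      filter_upwards [Ioo_mem_nhds hr.1 hr.2] with x hx
      exact (hd x hx).deriv
    rw [h4]
    exact h3.hasDerivAt
  have h5 := ((hasDerivAt_id r).mul h2).neg
  refine h5.congr_deriv ?_
  rw [← hode r hr, radLap, (hd r hr).deriv]
  have := hr.1.ne'
  simp only [id]
  field_simp
  ring

theorem src_mono {lam bet x y : ℝ} (hl : 0 ≤ lam) (hb : 0 ≤ bet) (hx : 0 ≤ x) (hxy : x ≤ y) :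
    src lam bet x ≤ src lam bet y := by
  unfold src
  have : 0 ≤ y := hx.trans hxy
  gcongr

theorem src_pos {lam bet x : ℝ} (hl : 0 < lam) (hb : 0 ≤ bet) (hx : 0 < x) :
    0 < src lam bet x := by
  unfold src
  positivity

theorem hasDerivAt_src (lam bet x : ℝ) :
    HasDerivAt (src lam bet) (lam + bet * (1 + 2 * x ^ 2) * exp (x ^ 2)) x := by
  have h1 := ((hasDerivAt_id x).const_mul lam).add
    (((hasDerivAt_id x).const_mul bet).mul ((hasDerivAt_pow 2 x).exp))
  refine h1.congr_deriv ?_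
  simp only [id]
  push_cast
  ring

theorem continuous_src (lam bet : ℝ) : Continuous (src lam bet) := by
  unfold src
  fun_prop

namespace RadODE

variable {lam bet : ℝ} {u p : ℝ → ℝ}

theorem cont_flux (h : RadODE lam bet u p) : ContinuousOn (flux p) (Icc 0 1) :=
  (continuousOn_id.mul h.cont_deriv).neg

theorem nonneg (h : RadODE lam bet u p) {r : ℝ} (hr : r ∈ Icc (0:ℝ) 1) : 0 ≤ u r := by
  rcases hr.2.lt_or_eq with h1 | h1
  · exact (h.pos r ⟨hr.1, h1⟩).le
  · rw [h1, h.bdry]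

theorem flux_mono (h : RadODE lam bet u p) {a b : ℝ} (ha : 0 ≤ a) (hab : a ≤ b) (hb : b ≤ 1) :
    flux p a ≤ flux p b := by
  refine le_of_hasDerivAt_nonneg hab (h.cont_flux.mono (Icc_subset_Icc ha hb))
    (fun x hx => h.hasDerivAt_flux x ⟨ha.trans_lt hx.1, hx.2.trans_le hb⟩) ?_
  intro x hx
  have h0 : 0 < x := ha.trans_lt hx.1
  exact mul_nonneg h0.le
    (src_pos h.lam_pos h.bet_nonneg (h.pos x ⟨h0.le, hx.2.trans_le hb⟩)).le

theorem flux_zero : flux p 0 = 0 := by simp [flux]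

theorem flux_nonneg (h : RadODE lam bet u p) {r : ℝ} (hr : r ∈ Icc (0:ℝ) 1) : 0 ≤ flux p r := by
  have := h.flux_mono le_rfl hr.1 hr.2
  rwa [flux_zero] at this

theorem deriv_eq (p : ℝ → ℝ) {r : ℝ} (hr : 0 < r) : p r = -(flux p r / r) := by
  unfold flux
  field_simp

theorem deriv_nonpos (h : RadODE lam bet u p) {r : ℝ} (hr : r ∈ Ioc (0:ℝ) 1) : p r ≤ 0 := by
  rw [deriv_eq p hr.1, neg_nonpos]
  exact div_nonneg (h.flux_nonneg ⟨hr.1.le, hr.2⟩) hr.1.le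

theorem anti (h : RadODE lam bet u p) {a b : ℝ} (ha : 0 ≤ a) (hab : a ≤ b) (hb : b ≤ 1) :
    u b ≤ u a := by
  have := le_of_hasDerivAt_nonneg (f := fun x => - u x) hab
    (h.cont.mono (Icc_subset_Icc ha hb)).neg
    (fun x hx => (h.hasDerivAt x ⟨ha.trans_lt hx.1, hx.2.trans_le hb⟩).neg)
    (fun x hx => neg_nonneg.2 (h.deriv_nonpos ⟨ha.trans_lt hx.1, (hx.2.trans_le hb).le⟩))
  simpa using this

theorem le_center (h : RadODE lam bet u p) {r : ℝ} (hr : r ∈ Icc (0:ℝ) 1) : u r ≤ u 0 :=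
  h.anti le_rfl hr.1 hr.2

theorem center_pos (h : RadODE lam bet u p) : 0 < u 0 := h.pos 0 ⟨le_rfl, one_pos⟩

theorem flux_le (h : RadODE lam bet u p) {r : ℝ} (hr : r ∈ Icc (0:ℝ) 1) :
    flux p r ≤ r ^ 2 / 2 * src lam bet (u 0) := by
  have := sub_le_sub_of_hasDerivAt_le (f := flux p)
    (g := fun x => x ^ 2 / 2 * src lam bet (u 0)) hr.1
    (h.cont_flux.mono (Icc_subset_Icc le_rfl hr.2)) (by fun_prop)
    (fun x hx => h.hasDerivAt_flux x ⟨hx.1, hx.2.trans_le hr.2⟩)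
    (fun x _ => (((hasDerivAt_pow 2 x).div_const 2).mul_const _)) (by
      intro x hx
      have hx1 : x < 1 := hx.2.trans_le hr.2
      have := src_mono h.lam_pos.le h.bet_nonneg (h.nonneg ⟨hx.1.le, hx1.le⟩)
        (h.le_center ⟨hx.1.le, hx1.le⟩)
      have := mul_le_mul_of_nonneg_left this hx.1.le
      push_cast
      simpa using this)
  simpa [flux_zero] using this

theorem le_flux (h : RadODE lam bet u p) {r : ℝ} (hr : r ∈ Icc (0:ℝ) 1) :
    r ^ 2 / 2 * src lam bet (u r) ≤ flux p r := by
  have := sub_le_sub_of_hasDerivAt_le (g := flux p)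
    (f := fun x => x ^ 2 / 2 * src lam bet (u r)) hr.1 (by fun_prop)
    (h.cont_flux.mono (Icc_subset_Icc le_rfl hr.2)) 
    (fun x _ => (((hasDerivAt_pow 2 x).div_const 2).mul_const _))
    (fun x hx => h.hasDerivAt_flux x ⟨hx.1, hx.2.trans_le hr.2⟩) (by
      intro x hx
      have hx1 : x < 1 := hx.2.trans_le hr.2
      have := src_mono h.lam_pos.le h.bet_nonneg (h.nonneg hr) (h.anti hx.1.le hx.2.le hr.2)
      have := mul_le_mul_of_nonneg_left this hx.1.le
      push_cast
      simpa using this)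
  simpa [flux_zero] using this

theorem flux_pos (h : RadODE lam bet u p) {r : ℝ} (hr : r ∈ Ioo (0:ℝ) 1) : 0 < flux p r := by
  refine lt_of_lt_of_le ?_ (h.le_flux (Ioo_subset_Icc_self hr))
  have := src_pos h.lam_pos h.bet_nonneg (h.pos r (Ioo_subset_Ico_self hr))
  have := hr.1
  positivity

theorem center_sub_le (h : RadODE lam bet u p) {r : ℝ} (hr : r ∈ Icc (0:ℝ) 1) :
    u 0 - r ^ 2 / 4 * src lam bet (u 0) ≤ u r := by
  have := sub_le_sub_of_hasDerivAt_le (g := u)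
    (f := fun x => -(x ^ 2 / 4 * src lam bet (u 0))) hr.1 (by fun_prop)
    (h.cont.mono (Icc_subset_Icc le_rfl hr.2)) 
    (fun x _ => (((hasDerivAt_pow 2 x).div_const 4).mul_const _).neg)
    (fun x hx => h.hasDerivAt x ⟨hx.1, hx.2.trans_le hr.2⟩) (by
      intro x hx
      have hx1 : x < 1 := hx.2.trans_le hr.2
      have h1 := h.flux_le ⟨hx.1.le, hx1.le⟩
      rw [deriv_eq p hx.1]
      have : flux p x / x ≤ x ^ 2 / 2 * src lam bet (u 0) / x := by
        have := hx.1
        gcongr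
      have h2 : x ^ 2 / 2 * src lam bet (u 0) / x = x / 2 * src lam bet (u 0) := by
        have := hx.1.ne'
        field_simp
      push_cast
      rw [h2] at this
      ring_nf at this ⊢
      linarith)
  simp at this
  linarith

end RadODE

/-- The slope parameter `g + 1/g` of the comparison bubble of height `g`. -/
def steep (g : ℝ) : ℝ := g + g⁻¹

theorem steep_pos {g : ℝ} (hg : 0 < g) : 0 < steep g := by
  unfold steep; positivity

/-- The inverse squared radius of the comparison bubble of height `g`. -/
def conc (lam bet g : ℝ) : ℝ := steep g * src lam bet g / 4

theorem conc_pos {lam bet g : ℝ} (hl : 0 < lam) (hb : 0 ≤ bet) (hg : 0 < g) :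
    0 < conc lam bet g := by
  have := steep_pos hg
  have := src_pos hl hb hg
  unfold conc; positivity

namespace RadODE

variable {lam bet : ℝ} {u p : ℝ → ℝ}

theorem riccati (h : RadODE lam bet u p) {r : ℝ} (hr : r ∈ Icc (0:ℝ) 1) (hur : (u 0)⁻¹ ≤ u r) :
    2 * flux p r - steep (u 0) * flux p r ^ 2 ≤ r ^ 2 * src lam bet (u r) := by
  have hg := h.center_pos
  have hsub : Icc 0 r ⊆ Icc (0:ℝ) 1 := Icc_subset_Icc le_rfl hr.2
  have cf := h.cont_flux.mono hsub
  have cu := h.cont.mono hsub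
  have key := le_of_hasDerivAt_nonneg (a := 0) (b := r)
    (f := fun x => x ^ 2 * src lam bet (u x) - 2 * flux p x + steep (u 0) * flux p x ^ 2)
    (f' := fun x => x⁻¹ * flux p x * x * (2 * steep (u 0) * src lam bet (u x)
        - (lam + bet * (1 + 2 * (u x) ^ 2) * exp ((u x) ^ 2))) * x) hr.1
    (((continuousOn_pow 2).mul ((continuous_src lam bet).comp_continuousOn cu)).sub
      (cf.const_smul (2:ℝ)) |>.add ((cf.pow 2).const_smul (steep (u 0)))) ?_ ?_
  · simp only [flux_zero] at key
    norm_num at key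
    linarith
  · intro x hx
    have hx1 : x ∈ Ioo (0:ℝ) 1 := ⟨hx.1, hx.2.trans_le hr.2⟩
    have d1 := h.hasDerivAt x hx1
    have d2 := h.hasDerivAt_flux x hx1
    have d3 := (hasDerivAt_src lam bet (u x)).comp x d1
    have d4 := (((hasDerivAt_pow 2 x).mul d3).sub (d2.const_mul 2)).add
      ((d2.pow 2).const_mul (steep (u 0)))
    refine d4.congr_deriv ?_
    have := hx.1.ne'
    simp only [Function.comp]
    rw [deriv_eq p hx.1]
    push_cast
    field_simp
    ring
  · intro x hx
    have hx1 : x ∈ Ioo (0:ℝ) 1 := ⟨hx.1, hx.2.trans_le hr.2⟩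
    have hf := h.flux_nonneg (Ioo_subset_Icc_self hx1)
    have hx0 := hx.1
    refine mul_nonneg (mul_nonneg (by positivity) ?_) hx0.le
    have hux : (u 0)⁻¹ ≤ u x := hur.trans (h.anti hx0.le hx.2.le hr.2)
    have hux' : u x ≤ u 0 := h.le_center (Ioo_subset_Icc_self hx1)
    have hup : 0 < u x := h.pos x (Ioo_subset_Ico_self hx1)
    have h1 : 1 ≤ u 0 * u x := by
      have := mul_le_mul_of_nonneg_left hux hg.le
      rwa [mul_inv_cancel₀ hg.ne'] at this
    have h2 : 1 + 2 * (u x) ^ 2 ≤ 2 * steep (u 0) * u x := by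
      unfold steep
      rcases le_total (u x) (u 0 / 2) with hc | hc
      · have : u x * u x ≤ u 0 / 2 * u x := by gcongr
        have : 0 ≤ (u 0)⁻¹ * u x := by positivity
        nlinarith
      · have : (u 0)⁻¹ * (u 0 / 2) ≤ (u 0)⁻¹ * u x := by gcongr
        have e : (u 0)⁻¹ * (u 0 / 2) = 1 / 2 := by field_simp
        have : u x * u x ≤ u 0 * u x := by gcongr
        nlinarith
    have h3 : lam ≤ 2 * steep (u 0) * (lam * u x) := by
      have : lam * (1 + 2 * u x ^ 2) ≤ lam * (2 * steep (u 0) * u x) :=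
        mul_le_mul_of_nonneg_left h2 h.lam_pos.le
      have : 0 ≤ lam * u x ^ 2 := by have := h.lam_pos; positivity
      nlinarith
    have h4 : bet * exp (u x ^ 2) * (1 + 2 * (u x) ^ 2)
        ≤ bet * exp (u x ^ 2) * (2 * steep (u 0) * u x) :=
      mul_le_mul_of_nonneg_left h2 (mul_nonneg h.bet_nonneg (exp_pos _).le)
    unfold src
    nlinarith

theorem sq_div_flux_le (h : RadODE lam bet u p) {r : ℝ} (hr : r ∈ Ioo (0:ℝ) 1)
    (hur : (u 0)⁻¹ ≤ u r) :
    r ^ 2 / flux p r ≤ 2 / src lam bet (u 0) + steep (u 0) / 2 * r ^ 2 := by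
  have hg := h.center_pos
  have hs := steep_pos hg
  have step : ∀ ρ ∈ Ioo 0 r, r ^ 2 / flux p r
      ≤ 2 / src lam bet (u ρ) + steep (u 0) / 2 * r ^ 2 := by
    intro ρ hρ
    have hρ1 : ρ ∈ Ioo (0:ℝ) 1 := ⟨hρ.1, hρ.2.trans hr.2⟩
    have key := sub_le_sub_of_hasDerivAt_le (a := ρ) (b := r)
      (f := fun x => x ^ 2 / flux p x) (g := fun x => steep (u 0) / 2 * x ^ 2) 
      (f' := fun x => (2 * x * flux p x - x ^ 2 * (x * src lam bet (u x))) / flux p x ^ 2)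
      (g' := fun x => steep (u 0) / 2 * (2 * x)) hρ.2.le ?_ (by fun_prop) ?_ ?_ ?_
    · have h1 : ρ ^ 2 / flux p ρ ≤ 2 / src lam bet (u ρ) := by
        have := h.le_flux (Ioo_subset_Icc_self hρ1)
        have hsp := src_pos h.lam_pos h.bet_nonneg (h.pos ρ (Ioo_subset_Ico_self hρ1))
        rw [div_le_div_iff₀ (h.flux_pos hρ1) hsp]
        linarith
      have : 0 ≤ steep (u 0) / 2 * ρ ^ 2 := by positivity
      linarith
    · refine (continuousOn_pow 2).div
        (h.cont_flux.mono (Icc_subset_Icc hρ.1.le hr.2.le)) ?_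
      intro x hx
      exact (h.flux_pos ⟨hρ.1.trans_le hx.1, hx.2.trans_lt hr.2⟩).ne'
    · intro x hx
      have hx1 : x ∈ Ioo (0:ℝ) 1 := ⟨hρ.1.trans hx.1, hx.2.trans hr.2⟩
      refine ((hasDerivAt_pow 2 x).div (h.hasDerivAt_flux x hx1) (h.flux_pos hx1).ne').congr_deriv ?_
      push_cast
      ring
    · intro x hx
      refine ((hasDerivAt_pow 2 x).const_mul _).congr_deriv ?_
      push_cast
      ring
    · intro x hx
      have hx1 : x ∈ Ioo (0:ℝ) 1 := ⟨hρ.1.trans hx.1, hx.2.trans hr.2⟩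
      have hfp := h.flux_pos hx1
      have := h.riccati (Ioo_subset_Icc_self hx1) (hur.trans (h.anti hx1.1.le hx.2.le hr.2.le))
      rw [div_le_iff₀ (by positivity)]
      have := mul_le_mul_of_nonneg_left this hx1.1.le
      nlinarith
  have hlim : Tendsto (fun ρ => 2 / src lam bet (u ρ) + steep (u 0) / 2 * r ^ 2) (𝓝[>] 0)
      (𝓝 (2 / src lam bet (u 0) + steep (u 0) / 2 * r ^ 2)) := by
    have hc : Tendsto u (𝓝[>] 0) (𝓝 (u 0)) :=
      ((h.cont 0 (left_mem_Icc.2 zero_le_one)).mono_of_mem_nhdsWithin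
        (Icc_mem_nhdsGT one_pos)).tendsto
    exact ((tendsto_const_nhds).div (((continuous_src lam bet).tendsto _).comp hc)
      (src_pos h.lam_pos h.bet_nonneg hg).ne').add tendsto_const_nhds
  refine ge_of_tendsto hlim ?_
  filter_upwards [Ioo_mem_nhdsGT hr.1] with ρ hρ using step ρ hρ

theorem bubble_le_flux (h : RadODE lam bet u p) {r : ℝ} (hr : r ∈ Ioo (0:ℝ) 1)
    (hur : (u 0)⁻¹ ≤ u r) :
    2 / steep (u 0) * (conc lam bet (u 0) * r ^ 2 / (1 + conc lam bet (u 0) * r ^ 2))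
      ≤ flux p r := by
  have hg := h.center_pos
  have hs := steep_pos hg
  have hsp := src_pos h.lam_pos h.bet_nonneg hg
  have hr0 := hr.1
  have hf := h.flux_pos hr
  have h1 := h.sq_div_flux_le hr hur
  have h2 : 0 < 1 + conc lam bet (u 0) * r ^ 2 := by
    have := conc_pos h.lam_pos h.bet_nonneg hg
    positivity
  rw [div_le_iff₀ hf] at h1
  have e : (2 / src lam bet (u 0) + steep (u 0) / 2 * r ^ 2)
      = 2 / src lam bet (u 0) * (1 + conc lam bet (u 0) * r ^ 2) := by
    unfold conc
    field_simp
    ring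
  rw [e] at h1
  rw [← mul_div_assoc, div_le_iff₀ h2]
  calc 2 / steep (u 0) * (conc lam bet (u 0) * r ^ 2) = src lam bet (u 0) / 2 * r ^ 2 := by
        unfold conc; field_simp; ring
    _ ≤ src lam bet (u 0) / 2 * (2 / src lam bet (u 0) * (1 + conc lam bet (u 0) * r ^ 2)
          * flux p r) := by gcongr
    _ = _ := by field_simp

theorem le_bubble (h : RadODE lam bet u p) {r : ℝ} (hr : r ∈ Ioo (0:ℝ) 1)
    (hur : (u 0)⁻¹ ≤ u r) :
    u r ≤ u 0 - (steep (u 0))⁻¹ * log (1 + conc lam bet (u 0) * r ^ 2) := by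
  have hg := h.center_pos
  have hs := steep_pos hg
  have hk := conc_pos h.lam_pos h.bet_nonneg hg
  have key := sub_le_sub_of_hasDerivAt_le (a := 0) (b := r)
    (g := fun x => - ((steep (u 0))⁻¹ * log (1 + conc lam bet (u 0) * x ^ 2))) (f := u)
    (f' := p) (g' := fun x => -((steep (u 0))⁻¹ * (conc lam bet (u 0) * (2 * x) /
      (1 + conc lam bet (u 0) * x ^ 2)))) hr.1.le
    (h.cont.mono (Icc_subset_Icc le_rfl hr.2.le)) ?_
    (fun x hx => h.hasDerivAt x ⟨hx.1, hx.2.trans hr.2⟩) ?_ ?_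
  · simp at key
    linarith
  · refine (continuousOn_const.mul (ContinuousOn.log (by fun_prop) ?_)).neg
    intro x _
    positivity
  · intro x hx
    have hne : 1 + conc lam bet (u 0) * x ^ 2 ≠ 0 := by positivity
    refine (((((hasDerivAt_pow 2 x).const_mul (conc lam bet (u 0))).const_add 1).log
      hne).const_mul (steep (u 0))⁻¹).neg.congr_deriv ?_
    push_cast
    ring
  · intro x hx
    have hx1 : x ∈ Ioo (0:ℝ) 1 := ⟨hx.1, hx.2.trans hr.2⟩
    have h1 := h.bubble_le_flux hx1 (hur.trans (h.anti hx1.1.le hx.2.le hr.2.le))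
    rw [deriv_eq p hx.1, neg_le_neg_iff, le_div_iff₀ hx.1]
    refine le_trans (le_of_eq ?_) h1
    field_simp

theorem bet_sq_le (h : RadODE lam bet u p) {r : ℝ} (hr : r ∈ Ioo (0:ℝ) 1)
    (hur : (u 0)⁻¹ ≤ u r) :
    bet * r ^ 2 ≤ 4 * exp 1 / (u 0) ^ 2 * exp (- (u 0 * u r)) := by
  have hg := h.center_pos
  have hs := steep_pos hg
  have hk := conc_pos h.lam_pos h.bet_nonneg hg
  have hr0 := hr.1
  have h1 := h.le_bubble hr hur
  have h2 : log (1 + conc lam bet (u 0) * r ^ 2) ≤ steep (u 0) * (u 0 - u r) := by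
    have : (steep (u 0))⁻¹ * log (1 + conc lam bet (u 0) * r ^ 2) ≤ u 0 - u r := by linarith
    rwa [inv_mul_le_iff₀ hs] at this
  rw [log_le_iff_le_exp (by positivity)] at h2
  have h3 : bet * u 0 ^ 2 * exp (u 0 ^ 2) / 4 ≤ conc lam bet (u 0) := by
    unfold conc
    have a1 : u 0 ≤ steep (u 0) := by unfold steep; have := inv_pos.2 hg; linarith
    have a2 : bet * u 0 * exp (u 0 ^ 2) ≤ src lam bet (u 0) := by
      unfold src; have := mul_pos h.lam_pos hg; linarith
    have a3 : u 0 * (bet * u 0 * exp (u 0 ^ 2)) ≤ steep (u 0) * src lam bet (u 0) :=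
      mul_le_mul a1 a2 (mul_nonneg (mul_nonneg h.bet_nonneg hg.le) (exp_pos _).le) hs.le
    linarith
  have h4 : steep (u 0) * (u 0 - u r) ≤ u 0 ^ 2 + 1 - u 0 * u r := by
    have e : steep (u 0) * (u 0 - u r) = u 0 ^ 2 + 1 - u 0 * u r - (u 0)⁻¹ * u r := by
      unfold steep; field_simp; ring
    have : 0 ≤ (u 0)⁻¹ * u r := mul_nonneg (inv_nonneg.2 hg.le) (h.nonneg ⟨hr.1.le, hr.2.le⟩)
    linarith
  have h5 : bet * u 0 ^ 2 * exp (u 0 ^ 2) / 4 * r ^ 2 ≤ exp (u 0 ^ 2 + 1 - u 0 * u r) := by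
    have := exp_le_exp.2 h4
    have := mul_le_mul_of_nonneg_right h3 (sq_nonneg r)
    linarith
  have e : exp (u 0 ^ 2 + 1 - u 0 * u r) = exp (u 0 ^ 2) * (exp 1 * exp (-(u 0 * u r))) := by
    rw [← exp_add, ← exp_add]; ring_nf
  rw [e] at h5
  have h6 : bet * u 0 ^ 2 / 4 * r ^ 2 ≤ exp 1 * exp (-(u 0 * u r)) := by
    refine le_of_mul_le_mul_left ?_ (exp_pos (u 0 ^ 2))
    linarith
  rw [div_mul_eq_mul_div, le_div_iff₀ (by positivity)]
  linarith

end RadODE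

/-! ### Decay of the nonlinear term -/

/-- The profile controlling the nonlinear term as a function of the value of the solution. -/
def dec (g x : ℝ) : ℝ := exp (-(g * (g - x) / 2)) + exp (-(g * x / 4)) / g ^ 2

/-- A primitive of `dec g`. -/
def decPrim (g x : ℝ) : ℝ := 2 / g * exp (-(g * (g - x) / 2)) - 4 / g ^ 3 * exp (-(g * x / 4))

theorem dec_pos {g : ℝ} (hg : 0 < g) (x : ℝ) : 0 < dec g x := by
  unfold dec; positivity

theorem hasDerivAt_decPrim {g : ℝ} (hg : 0 < g) (x : ℝ) :
    HasDerivAt (decPrim g) (dec g x) x := by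
  have h1 : HasDerivAt (fun x => -(g * (g - x) / 2)) (g / 2) x := by
    refine ((((hasDerivAt_id x).const_sub g).const_mul g).div_const 2).neg.congr_deriv ?_
    ring
  have h2 : HasDerivAt (fun x => -(g * x / 4)) (-(g / 4)) x := by
    refine (((hasDerivAt_id x).const_mul g).div_const 4).neg.congr_deriv ?_
    ring
  refine ((h1.exp.const_mul (2 / g)).sub (h2.exp.const_mul (4 / g ^ 3))).congr_deriv ?_
  unfold dec
  field_simp
  ring

theorem mul_exp_le_dec {g x : ℝ} (hx : 0 ≤ x) (hxg : x ≤ g) (hg : 0 < g) :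
    x * exp (-(g * x)) * exp (x ^ 2) ≤ 4 * g * dec g x := by
  have e : exp (-(g * x)) * exp (x ^ 2) = exp (-(x * (g - x))) := by
    rw [← exp_add]; ring_nf
  rw [mul_assoc, e]
  unfold dec
  rcases le_total (g / 2) x with hc | hc
  · have h1 : exp (-(x * (g - x))) ≤ exp (-(g * (g - x) / 2)) := by
      apply exp_le_exp.2
      have : g / 2 * (g - x) ≤ x * (g - x) := mul_le_mul_of_nonneg_right hc (by linarith)
      linarith
    have h2 : x * exp (-(x * (g - x))) ≤ g * exp (-(g * (g - x) / 2)) := by gcongr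
    have h3 : 0 ≤ g * exp (-(g * (g - x) / 2)) := by positivity
    have h4 : 0 ≤ g * (exp (-(g * x / 4)) / g ^ 2) := by positivity
    linarith
  · have h1 : exp (-(x * (g - x))) ≤ exp (-(g * x / 4)) * exp (-(g * x / 4)) := by
      rw [← exp_add]
      apply exp_le_exp.2
      have : x * (g / 2) ≤ x * (g - x) := mul_le_mul_of_nonneg_left (by linarith) hx
      linarith
    have h2 : g * x / 4 * exp (-(g * x / 4)) ≤ 1 := by
      have := add_one_le_exp (g * x / 4)
      rw [exp_neg, ← div_eq_mul_inv, div_le_one (exp_pos _)]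
      linarith
    have h3 : x * exp (-(x * (g - x))) ≤ 4 * g * (exp (-(g * x / 4)) / g ^ 2) := by
      calc x * exp (-(x * (g - x))) ≤ x * (exp (-(g * x / 4)) * exp (-(g * x / 4))) := by gcongr
        _ = 4 / g * (g * x / 4 * exp (-(g * x / 4))) * exp (-(g * x / 4)) := by field_simp
        _ ≤ 4 / g * 1 * exp (-(g * x / 4)) := by gcongr
        _ = _ := by field_simp
    have h4 : 0 ≤ 4 * g * exp (-(g * (g - x) / 2)) := by positivity
    linarith

/-- The numerical constant in the bounds for the nonlinear term. -/
def tailConst : ℝ := 16 * exp 6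

theorem one_le_tailConst : 1 ≤ tailConst := by
  unfold tailConst
  have := add_one_le_exp (6:ℝ)
  linarith

/-- The nonlinear part `β x exp(x²)` of the source. -/
def nl (bet x : ℝ) : ℝ := bet * x * exp (x ^ 2)

theorem continuous_nl (bet : ℝ) : Continuous (nl bet) := by
  unfold nl
  fun_prop

theorem src_eq (lam bet x : ℝ) : src lam bet x = lam * x + nl bet x := rfl

namespace RadODE

variable {lam bet : ℝ} {u p : ℝ → ℝ}

theorem nl_nonneg (h : RadODE lam bet u p) {r : ℝ} (hr : r ∈ Icc (0:ℝ) 1) : 0 ≤ nl bet (u r) :=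
  mul_nonneg (mul_nonneg h.bet_nonneg (h.nonneg hr)) (exp_pos _).le

theorem exists_eq (h : RadODE lam bet u p) {y : ℝ} (hy : 0 < y) (hyg : y < u 0) :
    ∃ r ∈ Ioo (0:ℝ) 1, u r = y :=
  intermediate_value_Ioo' zero_le_one h.cont ⟨by rwa [h.bdry], hyg⟩

theorem conc_of_lt (h : RadODE lam bet u p) {r : ℝ} (hr : r ∈ Icc (0:ℝ) 1)
    (hur : u r < u 0 - (steep (u 0))⁻¹) : 1 ≤ conc lam bet (u 0) * r ^ 2 := by
  by_contra! hlt
  have h1 := h.center_sub_le hr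
  have hs := steep_pos h.center_pos
  have e : r ^ 2 / 4 * src lam bet (u 0) = (steep (u 0))⁻¹ * (conc lam bet (u 0) * r ^ 2) := by
    unfold conc; field_simp
  have : (steep (u 0))⁻¹ * (conc lam bet (u 0) * r ^ 2) ≤ (steep (u 0))⁻¹ * 1 := by gcongr
  linarith

theorem inv_le_half {g : ℝ} (hg : 2 ≤ g) : g⁻¹ ≤ 1 / 2 := by
  rw [one_div]; exact inv_anti₀ two_pos hg

theorem steep_inv_le {g : ℝ} (hg : 0 < g) : (steep g)⁻¹ ≤ g⁻¹ := by
  refine inv_anti₀ hg ?_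
  unfold steep
  have := inv_pos.2 hg
  linarith

theorem steep_le {g : ℝ} (hg : 2 ≤ g) : steep g ≤ 2 * g := by
  have := inv_le_half hg
  unfold steep
  linarith

/-- Beyond the concentration radius the flux is bounded below. -/
theorem le_flux_of_conc (h : RadODE lam bet u p) (hg : 2 ≤ u 0) {r : ℝ} (hr : r ∈ Icc (0:ℝ) 1)
    (hc : 1 ≤ conc lam bet (u 0) * r ^ 2) : (steep (u 0))⁻¹ ≤ flux p r := by
  have hg0 := h.center_pos
  have hs := steep_pos hg0
  have aux : ∀ r ∈ Ioo (0:ℝ) 1, (u 0)⁻¹ ≤ u r → 1 ≤ conc lam bet (u 0) * r ^ 2 →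
      (steep (u 0))⁻¹ ≤ flux p r := by
    intro r hr hur hc
    refine le_trans ?_ (h.bubble_le_flux hr hur)
    have : (1:ℝ) / 2 ≤ conc lam bet (u 0) * r ^ 2 / (1 + conc lam bet (u 0) * r ^ 2) := by
      rw [div_le_div_iff₀ two_pos (by linarith)]
      linarith
    calc (steep (u 0))⁻¹ = 2 / steep (u 0) * (1 / 2) := by field_simp
      _ ≤ _ := by gcongr
  have hi := inv_le_half hg
  obtain ⟨r₁, hr₁, he⟩ := h.exists_eq (inv_pos.2 hg0) (by linarith : (u 0)⁻¹ < u 0)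
  have hr0 : 0 < r := by
    rcases hr.1.lt_or_eq with h0 | h0
    · exact h0
    · rw [← h0] at hc; norm_num at hc
  rcases le_total r r₁ with hle | hle
  · exact aux r ⟨hr0, hle.trans_lt hr₁.2⟩ (he ▸ h.anti hr0.le hle hr₁.2.le) hc
  · refine (aux r₁ hr₁ he.ge (h.conc_of_lt (Ioo_subset_Icc_self hr₁) ?_)).trans
      (h.flux_mono hr₁.1.le hle hr.2)
    have := steep_inv_le hg0
    linarith

theorem bet_le (h : RadODE lam bet u p) (hg : 2 ≤ u 0) : bet ≤ 4 * exp 4 / (u 0) ^ 2 := by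
  have hg0 := h.center_pos
  have hs := steep_pos hg0
  have hi := inv_le_half hg
  obtain ⟨r₁, hr₁, he⟩ := h.exists_eq (inv_pos.2 hg0) (by linarith : (u 0)⁻¹ < u 0)
  have hc₁ : 1 ≤ conc lam bet (u 0) * r₁ ^ 2 := by
    refine h.conc_of_lt (Ioo_subset_Icc_self hr₁) ?_
    have := steep_inv_le hg0
    linarith
  have key := sub_le_sub_of_hasDerivAt_le (a := r₁) (b := 1) (f := u)
    (g := fun x => -((steep (u 0))⁻¹ * log x)) (f' := p) (g' := fun x => -((steep (u 0))⁻¹ * x⁻¹))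
    hr₁.2.le (h.cont.mono (Icc_subset_Icc hr₁.1.le le_rfl))
    ((continuousOn_const.mul (continuousOn_log.mono
      (fun x hx => (hr₁.1.trans_le hx.1).ne'))).neg)
    (fun x hx => h.hasDerivAt x ⟨hr₁.1.trans hx.1, hx.2⟩)
    (fun x hx => ((hasDerivAt_log (hr₁.1.trans hx.1).ne').const_mul _).neg) (by
      intro x hx
      have hx0 : 0 < x := hr₁.1.trans hx.1
      have := (h.le_flux_of_conc hg (Ioo_subset_Icc_self hr₁) hc₁).trans
        (h.flux_mono hr₁.1.le hx.1.le hx.2.le)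
      rw [deriv_eq p hx0, neg_le_neg_iff, div_eq_mul_inv]
      gcongr)
  rw [h.bdry, he, log_one, mul_zero] at key
  have h1 : - log r₁ ≤ 2 := by
    have : (steep (u 0))⁻¹ * (- log r₁) ≤ (u 0)⁻¹ := by linarith
    rw [inv_mul_le_iff₀ hs] at this
    have h2 : steep (u 0) * (u 0)⁻¹ ≤ 2 * u 0 * (u 0)⁻¹ := by
      have := steep_le hg
      gcongr
    have e : 2 * u 0 * (u 0)⁻¹ = 2 := by field_simp
    linarith
  have h2 : exp (-2) ≤ r₁ := by
    rw [← exp_log hr₁.1]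
    exact exp_le_exp.2 (by linarith)
  have h3 : exp (-4) ≤ r₁ ^ 2 := by
    have : exp (-4) = exp (-2) ^ 2 := by rw [← exp_nat_mul]; norm_num
    rw [this]
    gcongr
  have h4 := h.bet_sq_le hr₁ he.ge
  rw [he, mul_inv_cancel₀ hg0.ne'] at h4
  have h5 : bet * exp (-4) ≤ 4 / u 0 ^ 2 := by
    have := mul_le_mul_of_nonneg_left h3 h.bet_nonneg
    have e : 4 * exp 1 / u 0 ^ 2 * exp (-1) = 4 / u 0 ^ 2 := by
      rw [exp_neg]; field_simp
    linarith
  rw [exp_neg, ← div_eq_mul_inv, div_le_iff₀ (exp_pos _)] at h5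
  linarith [div_mul_eq_mul_div 4 (u 0 ^ 2) (exp 4)]

theorem nl_le_dec (h : RadODE lam bet u p) (hg : 2 ≤ u 0) {r : ℝ} (hr : r ∈ Ioo (0:ℝ) 1) :
    r ^ 2 * nl bet (u r) ≤ tailConst / u 0 * dec (u 0) (u r) := by
  have hg0 := h.center_pos
  have hur := h.pos r (Ioo_subset_Ico_self hr)
  have hd := dec_pos hg0 (u r)
  have hr0 := hr.1
  unfold nl
  rcases le_total (u 0)⁻¹ (u r) with hc | hc
  · have h1 := h.bet_sq_le hr hc
    have h2 := mul_exp_le_dec hur.le (h.le_center (Ioo_subset_Icc_self hr)) hg0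
    calc r ^ 2 * (bet * u r * exp (u r ^ 2)) = bet * r ^ 2 * (u r * exp (u r ^ 2)) := by ring
      _ ≤ 4 * exp 1 / (u 0) ^ 2 * exp (- (u 0 * u r)) * (u r * exp (u r ^ 2)) := by gcongr
      _ = 4 * exp 1 / (u 0) ^ 2 * (u r * exp (- (u 0 * u r)) * exp (u r ^ 2)) := by ring
      _ ≤ 4 * exp 1 / (u 0) ^ 2 * (4 * u 0 * dec (u 0) (u r)) := by gcongr
      _ = 16 * exp 1 / u 0 * dec (u 0) (u r) := by field_simp; ring
      _ ≤ tailConst / u 0 * dec (u 0) (u r) := by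
        unfold tailConst
        gcongr
        norm_num
  · have h1 := h.bet_le hg
    have hi := inv_le_half hg
    have h3 : exp (-1) / u 0 ^ 2 ≤ dec (u 0) (u r) := by
      unfold dec
      have : exp (-1) ≤ exp (-(u 0 * u r / 4)) := by
        apply exp_le_exp.2
        have : u 0 * u r ≤ u 0 * (u 0)⁻¹ := by gcongr
        rw [mul_inv_cancel₀ hg0.ne'] at this
        linarith
      have h4 : exp (-1) / u 0 ^ 2 ≤ exp (-(u 0 * u r / 4)) / u 0 ^ 2 := by gcongr
      have := exp_pos (-(u 0 * (u 0 - u r) / 2))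
      linarith
    have h5 : u r ^ 2 ≤ 1 := by nlinarith
    calc r ^ 2 * (bet * u r * exp (u r ^ 2))
        ≤ 1 ^ 2 * (4 * exp 4 / (u 0) ^ 2 * (u 0)⁻¹ * exp 1) := by
          have := hr.2.le
          have := h.bet_nonneg
          gcongr
      _ = 4 * exp 6 / u 0 * (exp (-1) / u 0 ^ 2) := by
          have : exp 6 = exp 4 * exp 1 * exp 1 := by rw [← exp_add, ← exp_add]; norm_num
          rw [this, exp_neg]
          field_simp
      _ ≤ 16 * exp 6 / u 0 * dec (u 0) (u r) := by
          gcongr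
          norm_num

end RadODE

/-! ### Mass of the nonlinear term -/

theorem continuousOn_primitive {f : ℝ → ℝ} (hf : ContinuousOn f (Icc 0 1)) :
    ContinuousOn (fun r => ∫ s in (0:ℝ)..r, f s) (Icc 0 1) := by
  have := intervalIntegral.continuousOn_primitive_interval (μ := volume) (a := (0:ℝ)) (b := 1)
    (f := f) (by rw [uIcc_of_le zero_le_one]; exact hf.integrableOn_Icc)
  rwa [uIcc_of_le zero_le_one] at this

theorem hasDerivAt_primitive {f : ℝ → ℝ} (hf : ContinuousOn f (Icc 0 1)) {r : ℝ}
    (hr : r ∈ Ioo (0:ℝ) 1) : HasDerivAt (fun r => ∫ s in (0:ℝ)..r, f s) (f r) r := by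
  refine intervalIntegral.integral_hasDerivAt_right ?_ ?_ ?_
  · refine ContinuousOn.intervalIntegrable ?_
    rw [uIcc_of_le hr.1.le]
    exact hf.mono (Icc_subset_Icc le_rfl hr.2.le)
  · exact (hf.mono Ioo_subset_Icc_self).stronglyMeasurableAtFilter isOpen_Ioo r hr
  · exact hf.continuousAt (Icc_mem_nhds hr.1 hr.2)

theorem sub_eq_sub_of_hasDerivAt_eq {f g f' g' : ℝ → ℝ} {a b : ℝ} (hab : a ≤ b)
    (hf : ContinuousOn f (Icc a b)) (hg : ContinuousOn g (Icc a b))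
    (hdf : ∀ x ∈ Ioo a b, HasDerivAt f (f' x) x) (hdg : ∀ x ∈ Ioo a b, HasDerivAt g (g' x) x)
    (h : ∀ x ∈ Ioo a b, f' x = g' x) : f b - f a = g b - g a :=
  le_antisymm (sub_le_sub_of_hasDerivAt_le hab hf hg hdf hdg fun x hx => (h x hx).le)
    (sub_le_sub_of_hasDerivAt_le hab hg hf hdg hdf fun x hx => (h x hx).ge)

/-- The mass of the nonlinear term in the disk of radius `r`, up to the factor `2π`. -/
def nlMass (bet : ℝ) (u : ℝ → ℝ) (r : ℝ) : ℝ := ∫ s in (0:ℝ)..r, s * nl bet (u s)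

namespace RadODE

variable {lam bet : ℝ} {u p : ℝ → ℝ}

theorem cont_nl (h : RadODE lam bet u p) : ContinuousOn (fun s => nl bet (u s)) (Icc 0 1) :=
  (continuous_nl bet).comp_continuousOn h.cont

theorem cont_mul_nl (h : RadODE lam bet u p) :
    ContinuousOn (fun s => s * nl bet (u s)) (Icc 0 1) :=
  continuousOn_id.mul h.cont_nl

theorem cont_mass (h : RadODE lam bet u p) : ContinuousOn (nlMass bet u) (Icc 0 1) :=
  continuousOn_primitive h.cont_mul_nl

theorem hasDerivAt_mass (h : RadODE lam bet u p) {r : ℝ} (hr : r ∈ Ioo (0:ℝ) 1) :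
    HasDerivAt (nlMass bet u) (r * nl bet (u r)) r :=
  hasDerivAt_primitive h.cont_mul_nl hr

theorem mass_zero : nlMass bet u 0 = 0 := by simp [nlMass]

theorem mass_mono (h : RadODE lam bet u p) {a b : ℝ} (ha : 0 ≤ a) (hab : a ≤ b) (hb : b ≤ 1) :
    nlMass bet u a ≤ nlMass bet u b := by
  refine le_of_hasDerivAt_nonneg hab (h.cont_mass.mono (Icc_subset_Icc ha hb))
    (fun x hx => h.hasDerivAt_mass ⟨ha.trans_lt hx.1, hx.2.trans_le hb⟩) ?_
  intro x hx
  have h0 : 0 < x := ha.trans_lt hx.1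
  exact mul_nonneg h0.le (h.nl_nonneg ⟨h0.le, (hx.2.trans_le hb).le⟩)

theorem mass_nonneg (h : RadODE lam bet u p) {r : ℝ} (hr : r ∈ Icc (0:ℝ) 1) :
    0 ≤ nlMass bet u r := by
  have := h.mass_mono le_rfl hr.1 hr.2
  rwa [mass_zero] at this

theorem flux_eq (h : RadODE lam bet u p) {r : ℝ} (hr : r ∈ Icc (0:ℝ) 1) :
    flux p r = nlMass bet u r + lam * ∫ s in (0:ℝ)..r, s * u s := by
  have hsub : Icc 0 r ⊆ Icc (0:ℝ) 1 := Icc_subset_Icc le_rfl hr.2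
  have hc : ContinuousOn (fun s => s * u s) (Icc 0 1) := continuousOn_id.mul h.cont
  have := sub_eq_sub_of_hasDerivAt_eq (f := flux p)
    (g := fun r => nlMass bet u r + lam * ∫ s in (0:ℝ)..r, s * u s) hr.1
    (h.cont_flux.mono hsub)
    ((h.cont_mass.mono hsub).add (((continuousOn_primitive hc).mono hsub).const_smul lam))
    (fun x hx => h.hasDerivAt_flux x ⟨hx.1, hx.2.trans_le hr.2⟩)
    (fun x hx => (h.hasDerivAt_mass ⟨hx.1, hx.2.trans_le hr.2⟩).add
      ((hasDerivAt_primitive hc ⟨hx.1, hx.2.trans_le hr.2⟩).const_mul lam))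
    (fun x hx => by rw [src_eq]; ring)
  simpa [flux_zero, mass_zero] using this

theorem mass_le_flux (h : RadODE lam bet u p) {r : ℝ} (hr : r ∈ Icc (0:ℝ) 1) :
    nlMass bet u r ≤ flux p r := by
  rw [h.flux_eq hr]
  have : 0 ≤ ∫ s in (0:ℝ)..r, s * u s := intervalIntegral.integral_nonneg hr.1
    fun s hs => mul_nonneg hs.1 (h.nonneg ⟨hs.1, hs.2.trans hr.2⟩)
  have := mul_nonneg h.lam_pos.le this
  linarith

theorem mass_sub_le (h : RadODE lam bet u p) (hg : 2 ≤ u 0) {a b : ℝ} (ha : 0 < a) (hab : a ≤ b)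
    (hb : b ≤ 1) (hc : 1 ≤ conc lam bet (u 0) * a ^ 2) :
    nlMass bet u b - nlMass bet u a
      ≤ 2 * tailConst * (decPrim (u 0) (u a) - decPrim (u 0) (u b)) := by
  have hg0 := h.center_pos
  have hs := steep_pos hg0
  have hsub : Icc a b ⊆ Icc (0:ℝ) 1 := Icc_subset_Icc ha.le hb
  have hcd : Continuous (decPrim (u 0)) :=
    continuous_iff_continuousAt.2 fun x => (hasDerivAt_decPrim hg0 x).continuousAt
  have := sub_le_sub_of_hasDerivAt_le (f := nlMass bet u)
    (g := fun r => -(2 * tailConst * decPrim (u 0) (u r))) hab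
    (h.cont_mass.mono hsub)
    ((continuousOn_const.mul (hcd.comp_continuousOn (h.cont.mono hsub))).neg)
    (fun x hx => h.hasDerivAt_mass ⟨ha.trans hx.1, hx.2.trans_le hb⟩)
    (fun x hx => (((hasDerivAt_decPrim hg0 (u x)).comp x
      (h.hasDerivAt x ⟨ha.trans hx.1, hx.2.trans_le hb⟩)).const_mul (2 * tailConst)).neg) (by
      intro x hx
      have hx1 : x ∈ Ioo (0:ℝ) 1 := ⟨ha.trans hx.1, hx.2.trans_le hb⟩
      have hx0 := hx1.1
      have h1 := h.nl_le_dec hg hx1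
      have h2 := (h.le_flux_of_conc hg (hsub (left_mem_Icc.2 hab)) hc).trans
        (h.flux_mono ha.le hx.1.le hx1.2.le)
      have h3 : 1 ≤ 2 * u 0 * flux p x := by
        have := mul_le_mul_of_nonneg_left h2 hs.le
        rw [mul_inv_cancel₀ hs.ne'] at this
        have := mul_le_mul_of_nonneg_right (steep_le hg) (h.flux_nonneg (Ioo_subset_Icc_self hx1))
        linarith
      have hd := dec_pos hg0 (u x)
      have ht := one_le_tailConst
      rw [deriv_eq p hx0]
      have h4 : tailConst / u 0 * dec (u 0) (u x) * 1
          ≤ tailConst / u 0 * dec (u 0) (u x) * (2 * u 0 * flux p x) := by gcongr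
      have e : -(2 * tailConst * (dec (u 0) (u x) * -(flux p x / x)))
          = tailConst / u 0 * dec (u 0) (u x) * (2 * u 0 * flux p x) / x := by
        field_simp
      rw [e, le_div_iff₀ hx0]
      linarith)
  linarith

theorem mass_one_le (h : RadODE lam bet u p) (hg : 2 ≤ u 0) :
    nlMass bet u 1 ≤ 8 * tailConst / u 0 := by
  have hg0 := h.center_pos
  have hs := steep_pos hg0
  have ht := one_le_tailConst
  have hk := conc_pos h.lam_pos h.bet_nonneg hg0
  have hi := inv_le_half hg
  obtain ⟨r₁, hr₁, he⟩ := h.exists_eq (inv_pos.2 hg0) (by linarith : (u 0)⁻¹ < u 0)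
  have hc₁ : 1 ≤ conc lam bet (u 0) * r₁ ^ 2 := by
    refine h.conc_of_lt (Ioo_subset_Icc_self hr₁) ?_
    have := steep_inv_le hg0
    linarith
  set a := (sqrt (conc lam bet (u 0)))⁻¹ with ha
  have ha0 : 0 < a := inv_pos.2 (sqrt_pos.2 hk)
  have hca : conc lam bet (u 0) * a ^ 2 = 1 := by
    rw [ha, inv_pow, sq_sqrt hk.le, mul_inv_cancel₀ hk.ne']
  have ha1 : a ≤ 1 := by
    have : a ^ 2 ≤ r₁ ^ 2 := le_of_mul_le_mul_left (hca.le.trans hc₁) hk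
    exact ((pow_le_pow_iff_left₀ ha0.le hr₁.1.le two_ne_zero).1 this).trans hr₁.2.le
  have h1 := h.mass_sub_le hg ha0 ha1 le_rfl hca.ge
  have h2 : nlMass bet u a ≤ 2 / u 0 := by
    refine (h.mass_le_flux ⟨ha0.le, ha1⟩).trans ((h.flux_le ⟨ha0.le, ha1⟩).trans ?_)
    have e : a ^ 2 / 2 * src lam bet (u 0) = 2 * (conc lam bet (u 0) * a ^ 2) * (steep (u 0))⁻¹ := by
      unfold conc; field_simp; ring
    rw [e, hca]
    have := steep_inv_le hg0
    rw [div_eq_mul_inv]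
    linarith
  have h3 : decPrim (u 0) (u a) ≤ 2 / u 0 := by
    unfold decPrim
    have : exp (-(u 0 * (u 0 - u a) / 2)) ≤ 1 := by
      rw [exp_le_one_iff, neg_nonpos]
      have := h.le_center ⟨ha0.le, ha1⟩
      have : 0 ≤ u 0 - u a := by linarith
      positivity
    have h5 : 2 / u 0 * exp (-(u 0 * (u 0 - u a) / 2)) ≤ 2 / u 0 * 1 := by gcongr
    have h6 : 0 ≤ 4 / u 0 ^ 3 * exp (-(u 0 * u a / 4)) := by positivity
    linarith
  have h4 : - (1 / u 0) ≤ decPrim (u 0) (u 1) := by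
    unfold decPrim
    rw [h.bdry]
    have h5 : 0 ≤ 2 / u 0 * exp (-(u 0 * (u 0 - 0) / 2)) := by positivity
    have h6 : 4 / u 0 ^ 3 ≤ 1 / u 0 := by
      rw [div_le_div_iff₀ (by positivity) hg0]
      nlinarith [mul_pos hg0 hg0]
    simp only [mul_zero, zero_div, neg_zero, exp_zero, mul_one]
    linarith
  have h5 : 2 * tailConst * (decPrim (u 0) (u a) - decPrim (u 0) (u 1))
      ≤ 2 * tailConst * (3 * (1 / u 0)) := by
    gcongr
    have : 2 / u 0 = 2 * (1 / u 0) := by ring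
    linarith
  have h6 : 1 / u 0 ≤ tailConst * (1 / u 0) := by
    have : 0 < 1 / u 0 := by positivity
    nlinarith
  have e1 : 2 / u 0 = 2 * (1 / u 0) := by ring
  have e2 : 8 * tailConst / u 0 = 8 * (tailConst * (1 / u 0)) := by ring
  linarith

theorem intervalIntegrable_of_cont {f : ℝ → ℝ} (hf : ContinuousOn f (Icc 0 1)) :
    IntervalIntegrable f volume 0 1 := by
  refine ContinuousOn.intervalIntegrable ?_
  rwa [uIcc_of_le zero_le_one]

/-- Bounds for the nonlinear mass weighted by a decreasing function. -/
theorem weighted_mass (h : RadODE lam bet u p) {w : ℝ → ℝ} (hw : ContinuousOn w (Icc 0 1))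
    (hw0 : ∀ r ∈ Icc (0:ℝ) 1, 0 ≤ w r) (hwa : AntitoneOn w (Icc 0 1)) {r : ℝ}
    (hr : r ∈ Icc (0:ℝ) 1) :
    w r * nlMass bet u r ≤ ∫ s in (0:ℝ)..1, s * nl bet (u s) * w s ∧
      (∫ s in (0:ℝ)..1, s * nl bet (u s) * w s) ≤ w 0 * nlMass bet u 1 := by
  have hc : ContinuousOn (fun s => s * nl bet (u s) * w s) (Icc 0 1) := h.cont_mul_nl.mul hw
  have hnn : ∀ s ∈ Icc (0:ℝ) 1, 0 ≤ s * nl bet (u s) := fun s hs =>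
    mul_nonneg hs.1 (h.nl_nonneg hs)
  have hsub : Icc 0 r ⊆ Icc (0:ℝ) 1 := Icc_subset_Icc le_rfl hr.2
  constructor
  · have h1 := sub_le_sub_of_hasDerivAt_le (f := fun x => w r * nlMass bet u x)
      (g := fun x => ∫ s in (0:ℝ)..x, s * nl bet (u s) * w s) hr.1
      ((continuousOn_const.mul h.cont_mass).mono hsub) ((continuousOn_primitive hc).mono hsub)
      (fun x hx => (h.hasDerivAt_mass ⟨hx.1, hx.2.trans_le hr.2⟩).const_mul _)
      (fun x hx => hasDerivAt_primitive hc ⟨hx.1, hx.2.trans_le hr.2⟩) (by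
        intro x hx
        have hx1 : x ∈ Icc (0:ℝ) 1 := ⟨hx.1.le, hx.2.le.trans hr.2⟩
        have := mul_le_mul_of_nonneg_left (hwa hx1 hr hx.2.le) (hnn x hx1)
        linarith)
    have h2 := le_of_hasDerivAt_nonneg (f := fun x => ∫ s in (0:ℝ)..x, s * nl bet (u s) * w s)
      hr.2 ((continuousOn_primitive hc).mono (Icc_subset_Icc hr.1 le_rfl))
      (fun x hx => hasDerivAt_primitive hc ⟨hr.1.trans_lt hx.1, hx.2⟩) (by
        intro x hx
        have hx1 : x ∈ Icc (0:ℝ) 1 := ⟨hr.1.trans hx.1.le, hx.2.le⟩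
        exact mul_nonneg (hnn x hx1) (hw0 x hx1))
    simp [mass_zero] at h1
    linarith
  · have h1 := sub_le_sub_of_hasDerivAt_le (g := fun x => w 0 * nlMass bet u x)
      (f := fun x => ∫ s in (0:ℝ)..x, s * nl bet (u s) * w s) zero_le_one
      (continuousOn_primitive hc) (continuousOn_const.mul h.cont_mass)
      (fun x hx => hasDerivAt_primitive hc hx)
      (fun x hx => (h.hasDerivAt_mass hx).const_mul _) (by
        intro x hx
        have hx1 := Ioo_subset_Icc_self hx
        have := mul_le_mul_of_nonneg_left (hwa (left_mem_Icc.2 zero_le_one) hx1 hx.1.le)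
          (hnn x hx1)
        linarith)
    simpa [mass_zero] using h1

theorem antitoneOn (h : RadODE lam bet u p) : AntitoneOn u (Icc 0 1) :=
  fun _ ha _ hb hab => h.anti ha.1 hab hb.2

end RadODE

/-! ### Comparison with the eigenfunction -/

/-- The Wronskian `r (u' v - u v')` of two radial functions. -/
def wron (u p v q : ℝ → ℝ) (r : ℝ) : ℝ := flux q r * u r - flux p r * v r

namespace RadODE

variable {lam bet lam1 : ℝ} {u p v q : ℝ → ℝ}

theorem hasDerivAt_wron (h : RadODE lam bet u p) (hv : RadODE lam1 0 v q) {r : ℝ}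
    (hr : r ∈ Ioo (0:ℝ) 1) :
    HasDerivAt (wron u p v q)
      ((lam1 - lam) * (r * (u r * v r)) - r * nl bet (u r) * v r) r := by
  refine (((hv.hasDerivAt_flux r hr).mul (h.hasDerivAt r hr)).sub
    ((h.hasDerivAt_flux r hr).mul (hv.hasDerivAt r hr))).congr_deriv ?_
  rw [src_eq, src_eq]
  unfold flux nl
  ring

theorem cont_wron (h : RadODE lam bet u p) (hv : RadODE lam1 0 v q) :
    ContinuousOn (wron u p v q) (Icc 0 1) :=
  (hv.cont_flux.mul h.cont).sub (h.cont_flux.mul hv.cont)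

theorem cont_mul_mul (h : RadODE lam bet u p) (hv : RadODE lam1 0 v q) :
    ContinuousOn (fun s => s * (u s * v s)) (Icc 0 1) :=
  continuousOn_id.mul (h.cont.mul hv.cont)

theorem wron_eq (h : RadODE lam bet u p) (hv : RadODE lam1 0 v q) {r : ℝ}
    (hr : r ∈ Icc (0:ℝ) 1) :
    wron u p v q r = (lam1 - lam) * (∫ s in (0:ℝ)..r, s * (u s * v s))
      - ∫ s in (0:ℝ)..r, s * nl bet (u s) * v s := by
  have hsub : Icc 0 r ⊆ Icc (0:ℝ) 1 := Icc_subset_Icc le_rfl hr.2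
  have c1 := h.cont_mul_mul hv
  have c2 := h.cont_mul_nl.mul hv.cont
  have := sub_eq_sub_of_hasDerivAt_eq (f := wron u p v q)
    (g := fun r => (lam1 - lam) * (∫ s in (0:ℝ)..r, s * (u s * v s))
      - ∫ s in (0:ℝ)..r, s * nl bet (u s) * v s) hr.1 ((h.cont_wron hv).mono hsub)
    ((continuousOn_const.mul (continuousOn_primitive c1)).sub
      (continuousOn_primitive c2) |>.mono hsub)
    (fun x hx => h.hasDerivAt_wron hv ⟨hx.1, hx.2.trans_le hr.2⟩)
    (fun x hx => ((hasDerivAt_primitive c1 ⟨hx.1, hx.2.trans_le hr.2⟩).const_mul _).sub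
      (hasDerivAt_primitive c2 ⟨hx.1, hx.2.trans_le hr.2⟩)) (fun x _ => rfl)
  simpa [wron, flux_zero] using this

theorem duality (h : RadODE lam bet u p) (hv : RadODE lam1 0 v q) :
    (lam1 - lam) * (∫ s in (0:ℝ)..1, s * (u s * v s))
      = ∫ s in (0:ℝ)..1, s * nl bet (u s) * v s := by
  have := h.wron_eq hv (right_mem_Icc.2 zero_le_one)
  simp only [wron, h.bdry, hv.bdry] at this
  linarith

theorem weighted_eigen (h : RadODE lam bet u p) (hv : RadODE lam1 0 v q) {r : ℝ}
    (hr : r ∈ Icc (0:ℝ) 1) :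
    v r * nlMass bet u r ≤ ∫ s in (0:ℝ)..1, s * nl bet (u s) * v s ∧
      (∫ s in (0:ℝ)..1, s * nl bet (u s) * v s) ≤ v 0 * nlMass bet u 1 :=
  h.weighted_mass hv.cont (fun _ => hv.nonneg) hv.antitoneOn hr

theorem prim_mono {f : ℝ → ℝ} (hf : ContinuousOn f (Icc 0 1)) (h0 : ∀ x ∈ Ioo (0:ℝ) 1, 0 ≤ f x)
    {a b : ℝ} (ha : 0 ≤ a) (hab : a ≤ b) (hb : b ≤ 1) :
    ∫ s in (0:ℝ)..a, f s ≤ ∫ s in (0:ℝ)..b, f s :=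
  le_of_hasDerivAt_nonneg (f := fun x => ∫ s in (0:ℝ)..x, f s) hab
    ((continuousOn_primitive hf).mono (Icc_subset_Icc ha hb))
    (fun _ hx => hasDerivAt_primitive hf ⟨ha.trans_lt hx.1, hx.2.trans_le hb⟩)
    (fun x hx => h0 x ⟨ha.trans_lt hx.1, hx.2.trans_le hb⟩)

theorem abs_wron_le (h : RadODE lam bet u p) (hv : RadODE lam1 0 v q) (hlam : lam ≤ lam1)
    {r : ℝ} (hr : r ∈ Icc (0:ℝ) 1) : |wron u p v q r| ≤ v 0 * nlMass bet u 1 := by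
  have c1 := h.cont_mul_mul hv
  have c2 := h.cont_mul_nl.mul hv.cont
  have p1 : ∀ x ∈ Ioo (0:ℝ) 1, 0 ≤ x * (u x * v x) := fun x hx =>
    mul_nonneg hx.1.le (mul_nonneg (h.nonneg (Ioo_subset_Icc_self hx))
      (hv.nonneg (Ioo_subset_Icc_self hx)))
  have p2 : ∀ x ∈ Ioo (0:ℝ) 1, 0 ≤ x * nl bet (u x) * v x := fun x hx =>
    mul_nonneg (mul_nonneg hx.1.le (h.nl_nonneg (Ioo_subset_Icc_self hx)))
      (hv.nonneg (Ioo_subset_Icc_self hx))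
  have h1 := prim_mono c1 p1 hr.1 hr.2 le_rfl
  have h1' := prim_mono c1 p1 le_rfl hr.1 hr.2
  have h2 := prim_mono c2 p2 hr.1 hr.2 le_rfl
  have h2' := prim_mono c2 p2 le_rfl hr.1 hr.2
  rw [intervalIntegral.integral_same] at h1' h2'
  have h3 := (h.weighted_eigen hv hr).2
  have h4 := h.duality hv
  have h5 := mul_le_mul_of_nonneg_left h1 (sub_nonneg.2 hlam)
  have h6 := mul_nonneg (sub_nonneg.2 hlam) h1'
  rw [h.wron_eq hv hr, abs_le]
  simp only [Pi.mul_apply] at h2 h2'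
  constructor <;> linarith

theorem int_mul_eigen_le (h : RadODE lam bet u p) (hv : RadODE lam1 0 v q) (hlam : lam < lam1) :
    ∫ s in (0:ℝ)..1, s * (u s * v s) ≤ v 0 * nlMass bet u 1 / (lam1 - lam) := by
  rw [le_div_iff₀ (sub_pos.2 hlam), mul_comm, h.duality hv]
  exact (h.weighted_eigen hv (right_mem_Icc.2 zero_le_one)).2

theorem cont_id_mul (h : RadODE lam bet u p) : ContinuousOn (fun s => s * u s) (Icc 0 1) :=
  continuousOn_id.mul h.cont

theorem int_le (h : RadODE lam bet u p) (hv : RadODE lam1 0 v q) :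
    ∫ s in (0:ℝ)..1, s * u s ≤ 4 / v (1 / 2) * ∫ s in (0:ℝ)..1, s * (u s * v s) := by
  have c1 := h.cont_mul_mul hv
  have c2 := h.cont_id_mul
  have hvp : 0 < v (1 / 2) := hv.pos _ (by norm_num)
  have p1 : ∀ x ∈ Ioo (0:ℝ) 1, 0 ≤ x * (u x * v x) := fun x hx =>
    mul_nonneg hx.1.le (mul_nonneg (h.nonneg (Ioo_subset_Icc_self hx))
      (hv.nonneg (Ioo_subset_Icc_self hx)))
  have hsub : Icc (0:ℝ) (1 / 2) ⊆ Icc 0 1 := Icc_subset_Icc le_rfl (by norm_num)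
  have hsub' : Icc (1 / 2 : ℝ) 1 ⊆ Icc 0 1 := Icc_subset_Icc (by norm_num) le_rfl
  have m1 := prim_mono c1 p1 (a := 1 / 2) (by norm_num) (by norm_num) le_rfl
  have m2 := sub_le_sub_of_hasDerivAt_le (a := 0) (b := 1 / 2)
    (f := fun x => v (1 / 2) * ∫ s in (0:ℝ)..x, s * u s)
    (g := fun x => ∫ s in (0:ℝ)..x, s * (u s * v s)) (by norm_num)
    (continuousOn_const.mul (continuousOn_primitive c2) |>.mono hsub)
    ((continuousOn_primitive c1).mono hsub)
    (fun x hx => (hasDerivAt_primitive c2 ⟨hx.1, hx.2.trans (by norm_num)⟩).const_mul _)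
    (fun x hx => hasDerivAt_primitive c1 ⟨hx.1, hx.2.trans (by norm_num)⟩) (by
      intro x hx
      have := hv.anti hx.1.le hx.2.le (by norm_num)
      have hu := h.nonneg (hsub (Ioo_subset_Icc_self hx))
      have := mul_le_mul_of_nonneg_left this (mul_nonneg hx.1.le hu)
      linarith)
  have m3 := sub_le_sub_of_hasDerivAt_le (a := 0) (b := 1 / 2)
    (f := fun x => u (1 / 2) * (x ^ 2 / 2))
    (g := fun x => ∫ s in (0:ℝ)..x, s * u s) (by norm_num) (by fun_prop)
    ((continuousOn_primitive c2).mono hsub)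
    (fun x _ => ((hasDerivAt_pow 2 x).div_const 2).const_mul _)
    (fun x hx => hasDerivAt_primitive c2 ⟨hx.1, hx.2.trans (by norm_num)⟩) (by
      intro x hx
      have := mul_le_mul_of_nonneg_left (h.anti hx.1.le hx.2.le (by norm_num)) hx.1.le
      push_cast
      linarith)
  have m4 := sub_le_sub_of_hasDerivAt_le (a := 1 / 2) (b := 1)
    (g := fun x => u (1 / 2) * (x ^ 2 / 2))
    (f := fun x => ∫ s in (0:ℝ)..x, s * u s) (by norm_num)
    ((continuousOn_primitive c2).mono hsub') (by fun_prop)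
    (fun x hx => hasDerivAt_primitive c2 ⟨lt_trans (by norm_num) hx.1, hx.2⟩)
    (fun x _ => ((hasDerivAt_pow 2 x).div_const 2).const_mul _) (by
      intro x hx
      have h0 : 0 < x := lt_trans (by norm_num) hx.1
      have := mul_le_mul_of_nonneg_left (h.anti (by norm_num) hx.1.le hx.2.le) h0.le
      push_cast
      linarith)
  simp only [intervalIntegral.integral_same] at m2 m3
  norm_num at m1 m2 m3 m4 hvp
  rw [div_mul_eq_mul_div, le_div_iff₀ (by norm_num; exact hvp)]
  norm_num
  have : (∫ s in (0:ℝ)..1, s * u s) ≤ 4 * ∫ s in (0:ℝ)..1 / 2, s * u s := by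
    norm_num
    linarith
  norm_num at this
  have := mul_le_mul_of_nonneg_right this hvp.le
  linarith

/-! ### Pointwise bounds -/

theorem le_log (h : RadODE lam bet u p) {C : ℝ} (hC : flux p 1 ≤ C) {r : ℝ}
    (hr : r ∈ Ioc (0:ℝ) 1) : u r ≤ C * (-log r) := by
  have key := sub_le_sub_of_hasDerivAt_le (a := r) (b := 1) (g := u)
    (f := fun x => -(C * log x)) (g' := p) (f' := fun x => -(C * x⁻¹))
    hr.2 ((continuousOn_const.mul (continuousOn_log.mono
      (fun x hx => (hr.1.trans_le hx.1).ne'))).neg)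
    (h.cont.mono (Icc_subset_Icc hr.1.le le_rfl))
    (fun x hx => ((hasDerivAt_log (hr.1.trans hx.1).ne').const_mul _).neg)
    (fun x hx => h.hasDerivAt x ⟨hr.1.trans hx.1, hx.2⟩) (by
      intro x hx
      have hx0 : 0 < x := hr.1.trans hx.1
      have := (h.flux_mono hx0.le hx.2.le le_rfl).trans hC
      rw [deriv_eq p hx0, neg_le_neg_iff, div_eq_mul_inv]
      gcongr)
  rw [h.bdry, log_one] at key
  linarith

theorem neg_log_mul_le {r : ℝ} (hr : 0 < r) : r * (-log r) ≤ 1 := by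
  have := add_one_le_exp (-log r)
  rw [exp_neg, exp_log hr] at this
  have := mul_le_mul_of_nonneg_left this hr.le
  rw [mul_inv_cancel₀ hr.ne'] at this
  linarith

theorem flux_le_mass_add (h : RadODE lam bet u p) {C : ℝ} (hC : flux p 1 ≤ C) {r : ℝ}
    (hr : r ∈ Icc (0:ℝ) 1) : flux p r ≤ nlMass bet u r + lam * C * r := by
  have hsub : Icc 0 r ⊆ Icc (0:ℝ) 1 := Icc_subset_Icc le_rfl hr.2
  have hC0 : 0 ≤ C := (h.flux_nonneg (right_mem_Icc.2 zero_le_one)).trans hC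
  rw [h.flux_eq hr]
  have := sub_le_sub_of_hasDerivAt_le (f := fun r => ∫ s in (0:ℝ)..r, s * u s)
    (g := fun r => C * r) hr.1 ((continuousOn_primitive h.cont_id_mul).mono hsub) (by fun_prop)
    (fun x hx => hasDerivAt_primitive h.cont_id_mul ⟨hx.1, hx.2.trans_le hr.2⟩)
    (fun x _ => (hasDerivAt_id x).const_mul C) (by
      intro x hx
      have := h.le_log hC ⟨hx.1, (hx.2.trans_le hr.2).le⟩
      have := mul_le_mul_of_nonneg_left this hx.1.le
      have := mul_le_mul_of_nonneg_left (neg_log_mul_le hx.1) hC0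
      linarith)
  simp at this
  have := mul_le_mul_of_nonneg_left this h.lam_pos.le
  linarith

theorem le_log_add (h : RadODE lam bet u p) (hg : 2 ≤ u 0) {C : ℝ} (hC : flux p 1 ≤ C) {r : ℝ}
    (hr : r ∈ Ioc (0:ℝ) 1) : u r ≤ 8 * tailConst / u 0 * (-log r) + lam * C := by
  have hC0 : 0 ≤ C := (h.flux_nonneg (right_mem_Icc.2 zero_le_one)).trans hC
  have key := sub_le_sub_of_hasDerivAt_le (a := r) (b := 1) (g := u)
    (f := fun x => -(8 * tailConst / u 0 * log x + lam * C * x)) (g' := p)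
    (f' := fun x => -(8 * tailConst / u 0 * x⁻¹ + lam * C * 1))
    hr.2 ((continuousOn_const.mul (continuousOn_log.mono
      (fun x hx => (hr.1.trans_le hx.1).ne'))).add (by fun_prop)).neg
    (h.cont.mono (Icc_subset_Icc hr.1.le le_rfl))
    (fun x hx => (((hasDerivAt_log (hr.1.trans hx.1).ne').const_mul _).add
      ((hasDerivAt_id x).const_mul _)).neg)
    (fun x hx => h.hasDerivAt x ⟨hr.1.trans hx.1, hx.2⟩) (by
      intro x hx
      have hx0 : 0 < x := hr.1.trans hx.1
      have h1 := h.flux_le_mass_add hC ⟨hx0.le, hx.2.le⟩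
      have h2 := h.mass_mono hx0.le hx.2.le le_rfl
      have h3 := h.mass_one_le hg
      rw [deriv_eq p hx0, neg_le_neg_iff, div_le_iff₀ hx0]
      have e : (8 * tailConst / u 0 * x⁻¹ + lam * C * 1) * x
        = 8 * tailConst / u 0 + lam * C * x := by field_simp
      rw [e]
      linarith)
  rw [h.bdry, log_one] at key
  have : 0 ≤ lam * C * r := mul_nonneg (mul_nonneg h.lam_pos.le hC0) hr.1.le
  linarith

end RadODE

/-! ### The concentration region -/

theorem mul_dec_le {g x : ℝ} (hg : 2 ≤ g) (hx : g - 1 ≤ x) :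
    (g - x) * dec g x ≤ 4 / g * exp (-(g * (g - x) / 4)) + 8 / g ^ 4 := by
  have hg0 : 0 < g := by linarith
  unfold dec
  rw [mul_add]
  refine add_le_add ?_ ?_
  · have e : exp (-(g * (g - x) / 2)) = exp (-(g * (g - x) / 4)) * exp (-(g * (g - x) / 4)) := by
      rw [← exp_add]; ring_nf
    have h2 : g * (g - x) / 4 * exp (-(g * (g - x) / 4)) ≤ 1 := by
      have := add_one_le_exp (g * (g - x) / 4)
      rw [exp_neg, ← div_eq_mul_inv, div_le_one (exp_pos _)]
      linarith
    rw [e]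
    calc (g - x) * (exp (-(g * (g - x) / 4)) * exp (-(g * (g - x) / 4)))
        = 4 / g * (g * (g - x) / 4 * exp (-(g * (g - x) / 4))) * exp (-(g * (g - x) / 4)) := by
          field_simp
      _ ≤ 4 / g * 1 * exp (-(g * (g - x) / 4)) := by gcongr
      _ = _ := by ring
  · have h1 : exp (-(g * x / 4)) ≤ 8 / g ^ 2 := by
      have h3 : g ^ 2 / 8 ≤ g * x / 4 := by nlinarith
      have h4 := add_one_le_exp (g * x / 4)
      rw [exp_neg, inv_le_comm₀ (exp_pos _) (by positivity), inv_div]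
      linarith
    have h5 : g - x ≤ 1 := by linarith
    calc (g - x) * (exp (-(g * x / 4)) / g ^ 2) ≤ 1 * (8 / g ^ 2 / g ^ 2) := by gcongr
      _ = 8 / g ^ 4 := by field_simp

namespace RadODE

variable {lam bet : ℝ} {u p : ℝ → ℝ}

theorem core_conc (h : RadODE lam bet u p) (hg : 2 ≤ u 0) {r : ℝ} (hr : r ∈ Ioo (0:ℝ) 1)
    (hur : u r = u 0 - 1) : 1 ≤ conc lam bet (u 0) * r ^ 2 := by
  refine h.conc_of_lt (Ioo_subset_Icc_self hr) ?_
  have := inv_le_half hg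
  have := steep_inv_le h.center_pos
  linarith

theorem core_radius (h : RadODE lam bet u p) {C : ℝ} (hC : flux p 1 ≤ C)
    (hg : 2 + 2 * (lam * C) ≤ u 0) {r : ℝ} (hr : r ∈ Ioo (0:ℝ) 1) (hur : u r = u 0 - 1) :
    r ≤ exp (-(u 0 ^ 2 / (16 * tailConst))) := by
  have hg0 := h.center_pos
  have ht := one_le_tailConst
  have hC0 : 0 ≤ C := (h.flux_nonneg (right_mem_Icc.2 zero_le_one)).trans hC
  have h0 := mul_nonneg h.lam_pos.le hC0
  have h1 := h.le_log_add (by linarith) hC (Ioo_subset_Ioc_self hr)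
  have h2 : u 0 / 2 ≤ 8 * tailConst / u 0 * (-log r) := by linarith
  have h3 : u 0 ^ 2 / (16 * tailConst) ≤ -log r := by
    rw [div_mul_eq_mul_div, le_div_iff₀ hg0] at h2
    rw [div_le_iff₀ (by linarith)]
    linarith
  calc r = exp (log r) := (exp_log hr.1).symm
    _ ≤ _ := exp_le_exp.2 (by linarith)

theorem core_lower (h : RadODE lam bet u p) (hg : 2 ≤ u 0) {r : ℝ} (hr : r ∈ Ioo (0:ℝ) 1)
    (hur : u r = u 0 - 1) :
    2 - 2 * tailConst * dec (u 0) (u 0 - 1) - 2 * lam * (u 0 ^ 2 * r ^ 2)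
      ≤ steep (u 0) * flux p r := by
  have hg0 := h.center_pos
  have hs := steep_pos hg0
  have hi := inv_le_half hg
  have h1 := h.riccati (Ioo_subset_Icc_self hr) (by linarith)
  have h2 := h.le_flux_of_conc hg (Ioo_subset_Icc_self hr) (h.core_conc hg hr hur)
  have h3 := h.nl_le_dec hg hr
  have hm := h.flux_pos hr
  have hG : r ^ 2 * src lam bet (u r) ≤ lam * r ^ 2 * u 0 + tailConst / u 0 * dec (u 0) (u 0 - 1) := by
    rw [src_eq, mul_add]
    rw [hur] at h3 ⊢
    have : 0 ≤ lam * r ^ 2 := mul_nonneg h.lam_pos.le (sq_nonneg r)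
    linarith
  have hG0 : 0 ≤ lam * r ^ 2 * u 0 + tailConst / u 0 * dec (u 0) (u 0 - 1) := by
    have := h.lam_pos
    have := dec_pos hg0 (u 0 - 1)
    have := one_le_tailConst
    positivity
  have h4 : 1 ≤ 2 * u 0 * flux p r := by
    have := mul_le_mul_of_nonneg_left h2 hs.le
    rw [mul_inv_cancel₀ hs.ne'] at this
    have := mul_le_mul_of_nonneg_right (steep_le hg) hm.le
    linarith
  have h5 := mul_le_mul_of_nonneg_left h4 hG0
  have e : (lam * r ^ 2 * u 0 + tailConst / u 0 * dec (u 0) (u 0 - 1)) * (2 * u 0 * flux p r)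
      = (2 * lam * (u 0 ^ 2 * r ^ 2) + 2 * tailConst * dec (u 0) (u 0 - 1)) * flux p r := by
    field_simp
  refine le_of_mul_le_mul_right ?_ hm
  rw [e] at h5
  nlinarith

theorem core_upper (h : RadODE lam bet u p) (hg : 2 ≤ u 0) {r : ℝ} (hr : r ∈ Ioo (0:ℝ) 1)
    (hur : u r = u 0 - 1) :
    u 0 * flux p r ^ 2 - 2 * flux p r ≤ 2 * lam * (u 0 ^ 2 * r ^ 2)
      + 2 * tailConst / u 0 * (16 / u 0 ^ 2 + 8 / u 0 ^ 4) := by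
  have hg0 := h.center_pos
  have ht := one_le_tailConst
  have hsub : Icc 0 r ⊆ Icc (0:ℝ) 1 := Icc_subset_Icc le_rfl hr.2.le
  have cf := h.cont_flux.mono hsub
  have cu := h.cont.mono hsub
  have key := sub_le_sub_of_hasDerivAt_le (a := 0) (b := r)
    (f := fun x => x ^ 2 * src lam bet (u x) - 2 * flux p x + u 0 * flux p x ^ 2)
    (f' := fun x => flux p x / x * x ^ 2 * (2 * u 0 * src lam bet (u x)
        - (lam + bet * (1 + 2 * (u x) ^ 2) * exp ((u x) ^ 2))))
    (g := fun x => -(2 * lam * u 0 ^ 2 * r ^ 2 * u x + 2 * tailConst / u 0 *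
      (16 / u 0 ^ 2 * exp (-(u 0 * (u 0 - u x) / 4)) + 8 / u 0 ^ 4 * u x)))
    (g' := fun x => flux p x / x * (2 * lam * u 0 ^ 2 * r ^ 2 + 2 * tailConst / u 0 *
      (4 / u 0 * exp (-(u 0 * (u 0 - u x) / 4)) + 8 / u 0 ^ 4))) hr.1.le
    (((continuousOn_pow 2).mul ((continuous_src lam bet).comp_continuousOn cu)).sub
      (cf.const_smul (2:ℝ)) |>.add ((cf.pow 2).const_smul (u 0))) (by fun_prop) ?_ ?_ ?_
  · have hsr : 0 ≤ r ^ 2 * src lam bet (u r) :=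
      mul_nonneg (sq_nonneg r) (src_pos h.lam_pos h.bet_nonneg (h.pos r (Ioo_subset_Ico_self hr))).le
    rw [hur] at hsr
    simp only [flux_zero, hur, sub_self, mul_zero, zero_div, neg_zero, exp_zero] at key
    have he : 0 ≤ 2 * tailConst / u 0 *
      (16 / u 0 ^ 2 * exp (-(u 0 * (u 0 - (u 0 - 1)) / 4))) := by positivity
    ring_nf at key he hsr ⊢
    linarith
  · intro x hx
    have hx1 : x ∈ Ioo (0:ℝ) 1 := ⟨hx.1, hx.2.trans hr.2⟩
    have d1 := h.hasDerivAt x hx1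
    have d2 := h.hasDerivAt_flux x hx1
    have d3 := (hasDerivAt_src lam bet (u x)).comp x d1
    have d4 := (((hasDerivAt_pow 2 x).mul d3).sub (d2.const_mul 2)).add
      ((d2.pow 2).const_mul (u 0))
    refine d4.congr_deriv ?_
    have := hx.1.ne'
    simp only [Function.comp]
    rw [deriv_eq p hx.1]
    push_cast
    field_simp
    ring
  · intro x hx
    have hx1 : x ∈ Ioo (0:ℝ) 1 := ⟨hx.1, hx.2.trans hr.2⟩
    have d1 := h.hasDerivAt x hx1
    have d2 : HasDerivAt (fun x => -(u 0 * (u 0 - u x) / 4)) (u 0 * p x / 4) x := by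
      refine (((d1.const_sub (u 0)).const_mul (u 0)).div_const 4).neg.congr_deriv ?_
      ring
    refine ((d1.const_mul (2 * lam * u 0 ^ 2 * r ^ 2)).add
      (((d2.exp.const_mul (16 / u 0 ^ 2)).add (d1.const_mul (8 / u 0 ^ 4))).const_mul
        (2 * tailConst / u 0))).neg.congr_deriv ?_
    have := hx.1.ne'
    rw [deriv_eq p hx.1]
    field_simp
    ring
  · intro x hx
    have hx1 : x ∈ Ioo (0:ℝ) 1 := ⟨hx.1, hx.2.trans hr.2⟩
    have hx0 := hx.1
    have hfx : 0 ≤ flux p x / x := div_nonneg (h.flux_nonneg (Ioo_subset_Icc_self hx1)) hx0.le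
    rw [mul_assoc]
    refine mul_le_mul_of_nonneg_left ?_ hfx
    have hux : u 0 - 1 ≤ u x := hur ▸ h.anti hx0.le hx.2.le hr.2.le
    have hux' : u x ≤ u 0 := h.le_center (Ioo_subset_Icc_self hx1)
    have hup : 0 < u x := h.pos x (Ioo_subset_Ico_self hx1)
    have hl := h.lam_pos
    have hb := h.bet_nonneg
    have b1 : 2 * u 0 * src lam bet (u x) - (lam + bet * (1 + 2 * (u x) ^ 2) * exp ((u x) ^ 2))
        ≤ 2 * lam * u 0 ^ 2 + 2 * (u 0 - u x) * nl bet (u x) := by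
      have e1 : 0 ≤ bet * exp (u x ^ 2) := by positivity
      have e2 : 2 * u 0 * (lam * u x) ≤ 2 * u 0 * (lam * u 0) := by gcongr
      unfold src nl
      linarith
    have b2 : x ^ 2 * (2 * lam * u 0 ^ 2) ≤ r ^ 2 * (2 * lam * u 0 ^ 2) := by
      have := hx.2.le
      gcongr
    have b3 := h.nl_le_dec hg hx1
    have b4 := mul_dec_le hg hux
    have b5 : x ^ 2 * (2 * (u 0 - u x) * nl bet (u x)) ≤ 2 * tailConst / u 0 *
      (4 / u 0 * exp (-(u 0 * (u 0 - u x) / 4)) + 8 / u 0 ^ 4) := by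
      have : 0 ≤ u 0 - u x := by linarith
      calc x ^ 2 * (2 * (u 0 - u x) * nl bet (u x))
          = 2 * (u 0 - u x) * (x ^ 2 * nl bet (u x)) := by ring
        _ ≤ 2 * (u 0 - u x) * (tailConst / u 0 * dec (u 0) (u x)) := by gcongr
        _ = 2 * tailConst / u 0 * ((u 0 - u x) * dec (u 0) (u x)) := by ring
        _ ≤ _ := by gcongr
    have b6 := mul_le_mul_of_nonneg_left b1 (sq_nonneg x)
    linarith

theorem core_tail (h : RadODE lam bet u p) (hg : 2 ≤ u 0) {r : ℝ} (hr : r ∈ Ioo (0:ℝ) 1)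
    (hur : u r = u 0 - 1) :
    nlMass bet u 1 - nlMass bet u r
      ≤ 2 * tailConst * (2 / u 0 * exp (-(u 0 / 2)) + 4 / u 0 ^ 3) := by
  have hg0 := h.center_pos
  have ht := one_le_tailConst
  refine (h.mass_sub_le hg hr.1 hr.2.le le_rfl (h.core_conc hg hr hur)).trans ?_
  rw [h.bdry, hur]
  unfold decPrim
  have h1 : 0 ≤ 4 / u 0 ^ 3 * exp (-(u 0 * (u 0 - 1) / 4)) := by positivity
  have h2 : 0 ≤ 2 / u 0 * exp (-(u 0 * u 0 / 2)) := by positivity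
  have e : u 0 * (u 0 - (u 0 - 1)) / 2 = u 0 / 2 := by ring
  rw [e]
  simp only [mul_zero, zero_div, neg_zero, exp_zero, mul_one, sub_zero]
  gcongr
  linarith

end RadODE

/-! ### Blow-up families -/

/-- A family of radial solutions with central value `γ` and parameter `lam1 - c / γ`, where `lam1`
has the positive radial eigenfunction `v`. -/
structure Blowup (lam1 c : ℝ) (v q : ℝ → ℝ) (bet : ℝ → ℝ) (u p : ℝ → ℝ → ℝ) : Prop where
  eigen : RadODE lam1 0 v q
  c_pos : 0 < c
  ode : ∀ᶠ γ in atTop, RadODE (lam1 - c / γ) (bet γ) (u γ) (p γ) ∧ u γ 0 = γ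

theorem tendsto_pow_mul_exp_neg_mul (k : ℕ) {b : ℝ} (hb : 0 < b) :
    Tendsto (fun x : ℝ => x ^ k * exp (-(b * x))) atTop (𝓝 0) := by
  have := tendsto_pow_mul_exp_neg_atTop_nhds_zero k
  have h2 := (this.comp (tendsto_id.const_mul_atTop hb)).const_mul ((b ^ k)⁻¹)
  rw [mul_zero] at h2
  refine h2.congr fun x => ?_
  simp only [Function.comp, id, mul_pow]
  have : b ^ k ≠ 0 := pow_ne_zero _ hb.ne'
  field_simp

theorem tendsto_exp_neg_mul {b : ℝ} (hb : 0 < b) :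
    Tendsto (fun x : ℝ => exp (-(b * x))) atTop (𝓝 0) := by
  simpa using tendsto_pow_mul_exp_neg_mul 0 hb

theorem tendsto_div_pow_atTop_zero (a : ℝ) (k : ℕ) (hk : k ≠ 0) :
    Tendsto (fun x : ℝ => a / x ^ k) atTop (𝓝 0) :=
  tendsto_const_nhds.div_atTop (tendsto_pow_atTop hk)

namespace Blowup

variable {lam1 c : ℝ} {v q : ℝ → ℝ} {bet : ℝ → ℝ} {u p : ℝ → ℝ → ℝ}

/-- An upper bound for the boundary fluxes. -/
def fluxConst (lam1 c : ℝ) (v : ℝ → ℝ) : ℝ :=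
  4 * tailConst + lam1 * (4 / v (1 / 2) * (v 0 * (8 * tailConst) / c))

theorem lam_tendsto : Tendsto (fun γ : ℝ => lam1 - c / γ) atTop (𝓝 lam1) := by
  have := (tendsto_const_nhds (x := c)).div_atTop tendsto_id
  simpa using (tendsto_const_nhds (x := lam1)).sub this

theorem flux_one_le (hB : Blowup lam1 c v q bet u p) :
    ∀ᶠ γ in atTop, flux (p γ) 1 ≤ fluxConst lam1 c v := by
  filter_upwards [hB.ode, eventually_ge_atTop 2] with γ ⟨h, h0⟩ hγ
  have hg : 2 ≤ u γ 0 := by rw [h0]; exact hγ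
  have hγ0 : 0 < γ := by linarith
  have hc := hB.c_pos
  have ht := one_le_tailConst
  have hl := hB.eigen.lam_pos
  have hv0 := hB.eigen.center_pos
  have hv2 : 0 < v (1 / 2) := hB.eigen.pos _ (by norm_num)
  have hcg : 0 < c / γ := by positivity
  have h1 := h.mass_one_le hg
  rw [h0] at h1
  have h2 := h.int_mul_eigen_le hB.eigen (by linarith)
  have h3 := h.int_le hB.eigen
  have h4 : v 0 * nlMass (bet γ) (u γ) 1 / (lam1 - (lam1 - c / γ))
      ≤ v 0 * (8 * tailConst) / c := by
    calc v 0 * nlMass (bet γ) (u γ) 1 / (lam1 - (lam1 - c / γ))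
        = v 0 * nlMass (bet γ) (u γ) 1 / (c / γ) := by ring_nf
      _ ≤ v 0 * (8 * tailConst / γ) / (c / γ) := by gcongr
      _ = _ := by field_simp
  have h5 : 8 * tailConst / γ ≤ 4 * tailConst := by
    rw [div_le_iff₀ hγ0]
    nlinarith
  have h6 : ∫ s in (0:ℝ)..1, s * u γ s ≤ 4 / v (1 / 2) * (v 0 * (8 * tailConst) / c) :=
    h3.trans (mul_le_mul_of_nonneg_left (h2.trans h4) (by positivity))
  rw [h.flux_eq (right_mem_Icc.2 zero_le_one)]
  unfold fluxConst
  refine add_le_add (h1.trans h5) ?_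
  have h7 := h.lam_pos
  refine mul_le_mul (by linarith) h6 ?_ hl.le
  exact intervalIntegral.integral_nonneg zero_le_one fun s hs => mul_nonneg hs.1 (h.nonneg hs)

theorem fluxConst_pos (hB : Blowup lam1 c v q bet u p) : 0 < fluxConst lam1 c v := by
  have hc := hB.c_pos
  have ht := one_le_tailConst
  have hl := hB.eigen.lam_pos
  have hv0 := hB.eigen.center_pos
  have hv2 : 0 < v (1 / 2) := hB.eigen.pos _ (by norm_num)
  unfold fluxConst
  positivity

theorem exists_core (hB : Blowup lam1 c v q bet u p) :
    ∃ ρ : ℝ → ℝ, ∀ᶠ γ in atTop, ρ γ ∈ Ioo (0:ℝ) 1 ∧ u γ (ρ γ) = γ - 1 := by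
  have : ∀ᶠ γ in atTop, ∃ r, r ∈ Ioo (0:ℝ) 1 ∧ u γ r = γ - 1 := by
    filter_upwards [hB.ode, eventually_ge_atTop 2] with γ ⟨h, h0⟩ hγ
    exact h.exists_eq (by linarith) (by linarith)
  exact this.choice

theorem core_tendsto (hB : Blowup lam1 c v q bet u p) {ρ : ℝ → ℝ}
    (hρ : ∀ᶠ γ in atTop, ρ γ ∈ Ioo (0:ℝ) 1 ∧ u γ (ρ γ) = γ - 1) (k : ℕ) :
    Tendsto (fun γ => γ ^ k * ρ γ) atTop (𝓝 0) := by
  have ht := one_le_tailConst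
  have hb : 0 < (16 * tailConst)⁻¹ := by positivity
  refine squeeze_zero' ?_ ?_ (tendsto_pow_mul_exp_neg_mul k hb)
  · filter_upwards [hρ, eventually_ge_atTop 0] with γ hγ h0
    exact mul_nonneg (pow_nonneg h0 _) hγ.1.1.le
  · filter_upwards [hρ, hB.ode, hB.flux_one_le,
      eventually_ge_atTop (2 + 2 * (lam1 * fluxConst lam1 c v)), eventually_ge_atTop 2]
      with γ ⟨hr, hur⟩ ⟨h, h0⟩ hC hγ hγ2
    have hγ0 : 0 < γ := by linarith
    have hF := hB.fluxConst_pos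
    have h1 := h.core_radius hC (r := ρ γ) (by
      rw [h0]
      refine le_trans ?_ hγ
      have : 0 < c / γ := div_pos hB.c_pos hγ0
      have : (lam1 - c / γ) * fluxConst lam1 c v ≤ lam1 * fluxConst lam1 c v := by
        gcongr; linarith
      linarith) hr (by rw [h0]; exact hur)
    refine mul_le_mul_of_nonneg_left (h1.trans (exp_le_exp.2 (neg_le_neg ?_))) (by positivity)
    rw [h0, div_eq_inv_mul]
    refine mul_le_mul_of_nonneg_left ?_ hb.le
    nlinarith

theorem steep_div_tendsto : Tendsto (fun γ : ℝ => steep γ / γ) atTop (𝓝 1) := by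
  have h1 : Tendsto (fun γ : ℝ => 1 + 1 / γ ^ 2) atTop (𝓝 1) := by
    simpa using (tendsto_const_nhds (x := (1:ℝ))).add (tendsto_div_pow_atTop_zero 1 2 two_ne_zero)
  refine h1.congr' ?_
  filter_upwards [eventually_gt_atTop 0] with γ hγ
  unfold steep
  field_simp

theorem dec_core_tendsto : Tendsto (fun γ : ℝ => dec γ (γ - 1)) atTop (𝓝 0) := by
  have h1 := tendsto_exp_neg_mul (b := 1 / 2) (by norm_num)
  have h2 := tendsto_div_pow_atTop_zero 1 2 two_ne_zero
  have h3 : Tendsto (fun γ : ℝ => exp (-(1 / 2 * γ)) + 1 / γ ^ 2) atTop (𝓝 0) := by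
    simpa using h1.add h2
  refine squeeze_zero' ?_ ?_ h3
  · filter_upwards [eventually_gt_atTop 0] with γ hγ using (dec_pos hγ _).le
  · filter_upwards [eventually_ge_atTop 1] with γ hγ
    unfold dec
    refine add_le_add (exp_le_exp.2 (by linarith)) ?_
    have : exp (-(γ * (γ - 1) / 4)) ≤ 1 := by
      rw [exp_le_one_iff]
      have : 0 ≤ γ * (γ - 1) := mul_nonneg (by linarith) (by linarith)
      linarith
    gcongr

theorem flux_core_tendsto (hB : Blowup lam1 c v q bet u p) {ρ : ℝ → ℝ}
    (hρ : ∀ᶠ γ in atTop, ρ γ ∈ Ioo (0:ℝ) 1 ∧ u γ (ρ γ) = γ - 1) :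
    Tendsto (fun γ => γ * flux (p γ) (ρ γ)) atTop (𝓝 2) := by
  have hρ1 := hB.core_tendsto hρ 1
  have hsq : Tendsto (fun γ => γ ^ 2 * ρ γ ^ 2) atTop (𝓝 0) := by
    simpa [mul_pow] using hρ1.pow 2
  have hsq3 : Tendsto (fun γ => γ * (γ ^ 2 * ρ γ ^ 2)) atTop (𝓝 0) := by
    have := (hB.core_tendsto hρ 2).mul hρ1
    rw [mul_zero] at this
    refine this.congr fun γ => ?_
    ring
  have hlam : Tendsto (fun γ : ℝ => lam1 - c / γ) atTop (𝓝 lam1) := lam_tendsto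
  have hlow : Tendsto (fun γ => (2 - 2 * tailConst * dec γ (γ - 1)
      - 2 * (lam1 - c / γ) * (γ ^ 2 * ρ γ ^ 2)) / (steep γ / γ)) atTop (𝓝 2) := by
    have := (((tendsto_const_nhds (x := (2:ℝ))).sub
      (dec_core_tendsto.const_mul (2 * tailConst))).sub
      ((hlam.const_mul 2).mul hsq)).div steep_div_tendsto one_ne_zero
    simpa [Pi.div_def] using this
  set E : ℝ → ℝ := fun γ => 2 * (lam1 - c / γ) * (γ * (γ ^ 2 * ρ γ ^ 2))
      + 2 * tailConst * (16 / γ ^ 2 + 8 / γ ^ 4) with hE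
  have hE0 : Tendsto E atTop (𝓝 0) := by
    have := ((hlam.const_mul 2).mul hsq3).add (((tendsto_div_pow_atTop_zero 16 2 two_ne_zero).add
      (tendsto_div_pow_atTop_zero 8 4 (by norm_num))).const_mul (2 * tailConst))
    simpa using this
  have hup : Tendsto (fun γ => 1 + sqrt (1 + E γ)) atTop (𝓝 2) := by
    have := (tendsto_const_nhds (x := (1:ℝ))).add
      (((tendsto_const_nhds (x := (1:ℝ))).add hE0).sqrt)
    simp only [add_zero, sqrt_one] at this
    convert this using 2
    norm_num
  refine tendsto_of_tendsto_of_tendsto_of_le_of_le' hlow hup ?_ ?_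
  · filter_upwards [hρ, hB.ode, eventually_ge_atTop 2] with γ ⟨hr, hur⟩ ⟨h, h0⟩ hγ
    have hγ0 : 0 < γ := by linarith
    have hs := steep_pos hγ0
    have h1 := h.core_lower (by rw [h0]; exact hγ) hr (by rw [h0]; exact hur)
    rw [h0] at h1
    rw [div_le_iff₀ (by positivity)]
    refine h1.trans (le_of_eq ?_)
    field_simp
  · filter_upwards [hρ, hB.ode, eventually_ge_atTop 2] with γ ⟨hr, hur⟩ ⟨h, h0⟩ hγ
    have hγ0 : 0 < γ := by linarith
    have h1 := h.core_upper (by rw [h0]; exact hγ) hr (by rw [h0]; exact hur)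
    rw [h0] at h1
    have h2 : (γ * flux (p γ) (ρ γ) - 1) ^ 2 ≤ 1 + E γ := by
      have h3 := mul_le_mul_of_nonneg_left h1 hγ0.le
      have e1 : γ * (2 * (lam1 - c / γ) * (γ ^ 2 * ρ γ ^ 2)
          + 2 * tailConst / γ * (16 / γ ^ 2 + 8 / γ ^ 4)) = E γ := by
        rw [hE]; field_simp
      rw [e1] at h3
      linarith
    have := Real.le_sqrt_of_sq_le h2
    linarith

theorem mass_core_tendsto (hB : Blowup lam1 c v q bet u p) {ρ : ℝ → ℝ}
    (hρ : ∀ᶠ γ in atTop, ρ γ ∈ Ioo (0:ℝ) 1 ∧ u γ (ρ γ) = γ - 1) :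
    Tendsto (fun γ => γ * nlMass (bet γ) (u γ) (ρ γ)) atTop (𝓝 2) := by
  have h1 := hB.flux_core_tendsto hρ
  have h2 : Tendsto (fun γ => γ * flux (p γ) (ρ γ)
      - (lam1 - c / γ) * fluxConst lam1 c v * (γ ^ 1 * ρ γ)) atTop (𝓝 2) := by
    simpa using h1.sub (((lam_tendsto (lam1 := lam1) (c := c)).mul_const (fluxConst lam1 c v)).mul
      (hB.core_tendsto hρ 1))
  refine tendsto_of_tendsto_of_tendsto_of_le_of_le' h2 h1 ?_ ?_
  · filter_upwards [hρ, hB.ode, hB.flux_one_le, eventually_ge_atTop 2] with γ ⟨hr, _⟩ ⟨h, _⟩ hC hγ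
    have := h.flux_le_mass_add hC (Ioo_subset_Icc_self hr)
    have := mul_le_mul_of_nonneg_left this (by linarith : 0 ≤ γ)
    linarith
  · filter_upwards [hρ, hB.ode, eventually_ge_atTop 2] with γ ⟨hr, _⟩ ⟨h, _⟩ hγ
    exact mul_le_mul_of_nonneg_left (h.mass_le_flux (Ioo_subset_Icc_self hr)) (by linarith)

theorem mass_one_tendsto (hB : Blowup lam1 c v q bet u p) :
    Tendsto (fun γ => γ * nlMass (bet γ) (u γ) 1) atTop (𝓝 2) := by
  obtain ⟨ρ, hρ⟩ := hB.exists_core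
  have h1 := hB.mass_core_tendsto hρ
  have h2 : Tendsto (fun γ => γ * nlMass (bet γ) (u γ) (ρ γ)
      + 2 * tailConst * (2 * exp (-(1 / 2 * γ)) + 4 / γ ^ 2)) atTop (𝓝 2) := by
    simpa using h1.add ((((tendsto_exp_neg_mul (b := 1 / 2) (by norm_num)).const_mul 2).add
      (tendsto_div_pow_atTop_zero 4 2 two_ne_zero)).const_mul (2 * tailConst))
  refine tendsto_of_tendsto_of_tendsto_of_le_of_le' h1 h2 ?_ ?_
  · filter_upwards [hρ, hB.ode, eventually_ge_atTop 2] with γ ⟨hr, _⟩ ⟨h, _⟩ hγ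
    exact mul_le_mul_of_nonneg_left (h.mass_mono hr.1.le hr.2.le le_rfl) (by linarith)
  · filter_upwards [hρ, hB.ode, eventually_ge_atTop 2] with γ ⟨hr, hur⟩ ⟨h, h0⟩ hγ
    have hγ0 : 0 < γ := by linarith
    have h3 := h.core_tail (by rw [h0]; exact hγ) hr (by rw [h0]; exact hur)
    rw [h0] at h3
    have h4 := mul_le_mul_of_nonneg_left h3 hγ0.le
    have e : γ * (2 * tailConst * (2 / γ * exp (-(γ / 2)) + 4 / γ ^ 3))
        = 2 * tailConst * (2 * exp (-(1 / 2 * γ)) + 4 / γ ^ 2) := by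
      rw [show -(1 / 2 * γ) = -(γ / 2) by ring]
      field_simp
    rw [e] at h4
    linarith

theorem eigen_mass_tendsto (hB : Blowup lam1 c v q bet u p) :
    Tendsto (fun γ => γ * ∫ s in (0:ℝ)..1, s * nl (bet γ) (u γ s) * v s) atTop (𝓝 (v 0 * 2)) := by
  obtain ⟨ρ, hρ⟩ := hB.exists_core
  have h1 := hB.mass_core_tendsto hρ
  have hρ0 : Tendsto ρ atTop (𝓝[Icc 0 1] 0) := by
    refine tendsto_nhdsWithin_iff.2 ⟨by simpa using hB.core_tendsto hρ 0, ?_⟩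
    filter_upwards [hρ] with γ hγ using Ioo_subset_Icc_self hγ.1
  have hv : Tendsto (fun γ => v (ρ γ)) atTop (𝓝 (v 0)) :=
    (hB.eigen.cont 0 (left_mem_Icc.2 zero_le_one)).tendsto.comp hρ0
  refine tendsto_of_tendsto_of_tendsto_of_le_of_le' (hv.mul h1)
    (hB.mass_one_tendsto.const_mul (v 0)) ?_ ?_
  · filter_upwards [hρ, hB.ode, eventually_ge_atTop 2] with γ ⟨hr, _⟩ ⟨h, _⟩ hγ
    have := (h.weighted_eigen hB.eigen (Ioo_subset_Icc_self hr)).1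
    have := mul_le_mul_of_nonneg_left this (by linarith : 0 ≤ γ)
    linarith
  · filter_upwards [hρ, hB.ode, eventually_ge_atTop 2] with γ ⟨hr, _⟩ ⟨h, _⟩ hγ
    have := (h.weighted_eigen hB.eigen (Ioo_subset_Icc_self hr)).2
    have := mul_le_mul_of_nonneg_left this (by linarith : 0 ≤ γ)
    linarith

theorem inner_eigen_tendsto (hB : Blowup lam1 c v q bet u p) :
    Tendsto (fun γ => ∫ s in (0:ℝ)..1, s * (u γ s * v s)) atTop (𝓝 (v 0 * 2 / c)) := by
  refine (hB.eigen_mass_tendsto.div_const c).congr' ?_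
  filter_upwards [hB.ode, eventually_gt_atTop 0] with γ ⟨h, _⟩ hγ
  have hc := hB.c_pos
  rw [← h.duality hB.eigen]
  field_simp
  ring

theorem self_mass_tendsto (hB : Blowup lam1 c v q bet u p) :
    Tendsto (fun γ => ∫ s in (0:ℝ)..1, s * nl (bet γ) (u γ s) * u γ s) atTop (𝓝 2) := by
  obtain ⟨ρ, hρ⟩ := hB.exists_core
  have h1 := hB.mass_core_tendsto hρ
  have h2 : Tendsto (fun γ : ℝ => (1 - 1 / γ ^ 1) * (γ * nlMass (bet γ) (u γ) (ρ γ))) atTop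
      (𝓝 2) := by
    simpa using ((tendsto_const_nhds (x := (1:ℝ))).sub
      (tendsto_div_pow_atTop_zero 1 1 one_ne_zero)).mul h1
  refine tendsto_of_tendsto_of_tendsto_of_le_of_le' h2 hB.mass_one_tendsto ?_ ?_
  · filter_upwards [hρ, hB.ode, eventually_ge_atTop 2] with γ ⟨hr, hur⟩ ⟨h, _⟩ hγ
    have := (h.weighted_mass h.cont (fun _ => h.nonneg) h.antitoneOn (Ioo_subset_Icc_self hr)).1
    rw [hur] at this
    refine le_trans (le_of_eq ?_) this
    have : γ ≠ 0 := by linarith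
    field_simp
  · filter_upwards [hρ, hB.ode] with γ ⟨hr, _⟩ ⟨h, h0⟩
    have := (h.weighted_mass h.cont (fun _ => h.nonneg) h.antitoneOn (Ioo_subset_Icc_self hr)).2
    rwa [h0] at this

theorem bet_tendsto (hB : Blowup lam1 c v q bet u p) : Tendsto bet atTop (𝓝 0) := by
  refine squeeze_zero' ?_ ?_ (tendsto_div_pow_atTop_zero (4 * exp 4) 2 two_ne_zero)
  · filter_upwards [hB.ode] with γ ⟨h, _⟩ using h.bet_nonneg
  · filter_upwards [hB.ode, eventually_ge_atTop 2] with γ ⟨h, h0⟩ hγ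
    have := h.bet_le (by rw [h0]; exact hγ)
    rwa [h0] at this

end Blowup

theorem tendsto_integral_of_bdd {F : ℝ → ℝ → ℝ} {f : ℝ → ℝ} {C : ℝ}
    (hc : ∀ᶠ γ in atTop, ContinuousOn (F γ) (Icc 0 1))
    (hb : ∀ᶠ γ in atTop, ∀ x ∈ Ioo (0:ℝ) 1, |F γ x| ≤ C)
    (hl : ∀ x ∈ Ioo (0:ℝ) 1, Tendsto (fun γ => F γ x) atTop (𝓝 (f x)))
    {b : ℝ} (hb0 : 0 ≤ b) (hb1 : b ≤ 1) :
    Tendsto (fun γ => ∫ x in (0:ℝ)..b, F γ x) atTop (𝓝 (∫ x in (0:ℝ)..b, f x)) := by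
  have hne : ∀ᵐ x : ℝ, x ≠ 1 := by simp [ae_iff]
  have hmem : ∀ x : ℝ, x ≠ 1 → x ∈ uIoc 0 b → x ∈ Ioo (0:ℝ) 1 := fun x h1 hx => by
    rw [uIoc_of_le hb0] at hx
    exact ⟨hx.1, lt_of_le_of_ne (hx.2.trans hb1) h1⟩
  refine intervalIntegral.tendsto_integral_filter_of_dominated_convergence (fun _ => C) ?_ ?_
    intervalIntegrable_const ?_
  · filter_upwards [hc] with γ h
    refine (h.mono ?_).aestronglyMeasurable measurableSet_uIoc
    rw [uIoc_of_le hb0]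
    exact fun x hx => ⟨hx.1.le, hx.2.trans hb1⟩
  · filter_upwards [hb] with γ h
    filter_upwards [hne] with x h1 hx using h x (hmem x h1 hx)
  · filter_upwards [hne] with x h1 hx using hl x (hmem x h1 hx)

namespace RadODE

variable {lam bet lam1 : ℝ} {u p v q : ℝ → ℝ}

theorem ratio_le (h : RadODE lam bet u p) (hv : RadODE lam1 0 v q) (hlam : lam ≤ lam1)
    {a b : ℝ} (ha : 0 < a) (hab : a ≤ b) (hb : b < 1) :
    |u b / v b - u a / v a| ≤ v 0 / (a * v b ^ 2) * nlMass bet u 1 * (b - a) := by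
  have hvb : 0 < v b := hv.pos b ⟨(ha.trans_le hab).le, hb⟩
  have key := (convex_Icc a b).norm_image_sub_le_of_norm_hasDerivWithin_le
    (f := fun x => u x / v x) (f' := fun x => wron u p v q x / (x * v x ^ 2))
    (C := v 0 / (a * v b ^ 2) * nlMass bet u 1) ?_ ?_ (left_mem_Icc.2 hab) (right_mem_Icc.2 hab)
  · rw [norm_eq_abs, norm_eq_abs, abs_of_nonneg (sub_nonneg.2 hab)] at key
    exact key
  · intro x hx
    have hx1 : x ∈ Ioo (0:ℝ) 1 := ⟨ha.trans_le hx.1, hx.2.trans_lt hb⟩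
    have hvx := hv.pos x (Ioo_subset_Ico_self hx1)
    refine (((h.hasDerivAt x hx1).div (hv.hasDerivAt x hx1) hvx.ne').congr_deriv
      ?_).hasDerivWithinAt
    have := hx1.1
    unfold wron flux
    field_simp
    ring
  · intro x hx
    have hx1 : x ∈ Ioo (0:ℝ) 1 := ⟨ha.trans_le hx.1, hx.2.trans_lt hb⟩
    have hvx := hv.anti hx1.1.le hx.2 hb.le
    have hw := h.abs_wron_le hv hlam (Ioo_subset_Icc_self hx1)
    have hM := h.mass_nonneg (right_mem_Icc.2 zero_le_one)
    have hv0 := hv.center_pos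
    have hxp := hx1.1
    have hvp : 0 < v x := hvb.trans_le hvx
    rw [norm_eq_abs, abs_div, abs_of_pos (by positivity : 0 < x * v x ^ 2)]
    calc |wron u p v q x| / (x * v x ^ 2) ≤ v 0 * nlMass bet u 1 / (a * v b ^ 2) := by
          gcongr
          exact hx.1
      _ = _ := by ring

theorem sq_mul_le (h : RadODE lam bet u p) {C : ℝ} (hC : flux p 1 ≤ C) {r : ℝ}
    (hr : r ∈ Ioo (0:ℝ) 1) : r * u r ^ 2 ≤ (2 * C) ^ 2 := by
  have hC0 : 0 ≤ C := (h.flux_nonneg (right_mem_Icc.2 zero_le_one)).trans hC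
  have h1 := h.le_log hC (Ioo_subset_Ioc_self hr)
  have hs : 0 < √r := sqrt_pos.2 hr.1
  have h2 := neg_log_mul_le hs
  rw [log_sqrt hr.1.le] at h2
  have hu := h.nonneg (Ioo_subset_Icc_self hr)
  have h3 : √r * u r ≤ 2 * C := by
    have := mul_le_mul_of_nonneg_left h1 hs.le
    have := mul_le_mul_of_nonneg_left h2 hC0
    linarith
  have := pow_le_pow_left₀ (by positivity) h3 2
  rwa [mul_pow, sq_sqrt hr.1.le] at this

theorem id_mul_le (h : RadODE lam bet u p) {C : ℝ} (hC : flux p 1 ≤ C) {r : ℝ}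
    (hr : r ∈ Ioo (0:ℝ) 1) : r * u r ≤ C := by
  have hC0 : 0 ≤ C := (h.flux_nonneg (right_mem_Icc.2 zero_le_one)).trans hC
  have h1 := h.le_log hC (Ioo_subset_Ioc_self hr)
  have := mul_le_mul_of_nonneg_left h1 hr.1.le
  have := mul_le_mul_of_nonneg_left (neg_log_mul_le hr.1) hC0
  linarith

theorem energy_eq (h : RadODE lam bet u p) :
    ∫ s in (0:ℝ)..1, s * p s ^ 2
      = lam * (∫ s in (0:ℝ)..1, s * u s ^ 2) + ∫ s in (0:ℝ)..1, s * nl bet (u s) * u s := by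
  have c1 : ContinuousOn (fun s => s * p s ^ 2) (Icc 0 1) :=
    continuousOn_id.mul (h.cont_deriv.pow 2)
  have c2 : ContinuousOn (fun s => s * u s ^ 2) (Icc 0 1) := continuousOn_id.mul (h.cont.pow 2)
  have c3 : ContinuousOn (fun s => s * nl bet (u s) * u s) (Icc 0 1) := h.cont_mul_nl.mul h.cont
  have i1 := intervalIntegrable_of_cont c1
  have i2 := intervalIntegrable_of_cont c2
  have i3 := intervalIntegrable_of_cont c3
  have := intervalIntegral.integral_eq_sub_of_hasDerivAt_of_le zero_le_one
    (f := fun r => flux p r * u r)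
    (f' := fun s => lam * (s * u s ^ 2) + s * nl bet (u s) * u s - s * p s ^ 2)
    (h.cont_flux.mul h.cont) (fun x hx => ?_) (((i2.const_mul lam).add i3).sub i1)
  · rw [intervalIntegral.integral_sub ((i2.const_mul lam).add i3) i1,
      intervalIntegral.integral_add (i2.const_mul lam) i3, intervalIntegral.integral_const_mul,
      h.bdry, flux_zero] at this
    linarith
  · refine ((h.hasDerivAt_flux x hx).mul (h.hasDerivAt x hx)).congr_deriv ?_
    rw [src_eq]
    unfold flux
    ring

theorem int_sq_pos (h : RadODE lam bet u p) : 0 < ∫ s in (0:ℝ)..1, s * u s ^ 2 :=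
  intervalIntegral.intervalIntegral_pos_of_pos_on
    (intervalIntegrable_of_cont (continuousOn_id.mul (h.cont.pow 2)))
    (fun x hx => mul_pos hx.1 (pow_pos (h.pos x (Ioo_subset_Ico_self hx)) 2)) one_pos

end RadODE

namespace Blowup

variable {lam1 c : ℝ} {v q : ℝ → ℝ} {bet : ℝ → ℝ} {u p : ℝ → ℝ → ℝ}

theorem mass_tendsto_zero (hB : Blowup lam1 c v q bet u p) :
    Tendsto (fun γ => nlMass (bet γ) (u γ) 1) atTop (𝓝 0) := by
  refine (hB.mass_one_tendsto.div_atTop tendsto_id).congr' ?_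
  filter_upwards [eventually_gt_atTop 0] with γ hγ
  simp only [id]
  field_simp

theorem lam_le (hB : Blowup lam1 c v q bet u p) {γ : ℝ} (hγ : 0 < γ) : lam1 - c / γ ≤ lam1 := by
  have := div_pos hB.c_pos hγ
  linarith

theorem ratio_tendsto (hB : Blowup lam1 c v q bet u p) {r : ℝ} (hr : r ∈ Ioo (0:ℝ) 1) :
    Tendsto (fun γ => u γ r / v r - u γ (1 / 2) / v (1 / 2)) atTop (𝓝 0) := by
  have aux : ∀ a b : ℝ, 0 < a → a ≤ b → b < 1 →
      Tendsto (fun γ => u γ b / v b - u γ a / v a) atTop (𝓝 0) := by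
    intro a b ha hab hb
    have h0 : Tendsto (fun γ => v 0 / (a * v b ^ 2) * nlMass (bet γ) (u γ) 1 * (b - a)) atTop
        (𝓝 0) := by
      simpa using (hB.mass_tendsto_zero.const_mul (v 0 / (a * v b ^ 2))).mul_const (b - a)
    refine squeeze_zero_norm' ?_ h0
    filter_upwards [hB.ode, eventually_gt_atTop 0] with γ ⟨h, _⟩ hγ
    exact h.ratio_le hB.eigen (hB.lam_le hγ) ha hab hb
  rcases le_total r (1 / 2) with h | h
  · simpa using (aux r (1 / 2) hr.1 h (by norm_num)).neg
  · exact aux (1 / 2) r (by norm_num) h hr.2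

/-- The ratio of the weak limit to the eigenfunction. -/
def limRatio (c : ℝ) (v : ℝ → ℝ) : ℝ := v 0 * 2 / c / ∫ s in (0:ℝ)..1, s * v s ^ 2

theorem half_ratio_tendsto (hB : Blowup lam1 c v q bet u p) :
    Tendsto (fun γ => u γ (1 / 2) / v (1 / 2)) atTop (𝓝 (limRatio c v)) := by
  have hv := hB.eigen
  have hN := hv.int_sq_pos
  have hv0 := hv.center_pos
  have hv2 : 0 < v (1 / 2) := hv.pos _ (by norm_num)
  have hF := hB.fluxConst_pos
  set C := fluxConst lam1 c v with hCdef
  have cv : ContinuousOn (fun s => s * v s ^ 2) (Icc 0 1) := continuousOn_id.mul (hv.cont.pow 2)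
  have key := tendsto_integral_of_bdd (b := 1) (f := fun _ => 0)
    (F := fun γ s => s * (u γ s * v s) - u γ (1 / 2) / v (1 / 2) * (s * v s ^ 2))
    (C := C * v 0 + 2 * C / v (1 / 2) * v 0 ^ 2) ?_ ?_ ?_ zero_le_one le_rfl
  · simp only [intervalIntegral.integral_zero] at key
    have h1 := (hB.inner_eigen_tendsto.sub key).div_const (∫ s in (0:ℝ)..1, s * v s ^ 2)
    rw [sub_zero] at h1
    refine h1.congr' ?_
    filter_upwards [hB.ode] with γ ⟨h, _⟩
    rw [intervalIntegral.integral_sub (RadODE.intervalIntegrable_of_cont (h.cont_mul_mul hv))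
      ((RadODE.intervalIntegrable_of_cont cv).const_mul _), intervalIntegral.integral_const_mul,
      sub_sub_cancel, mul_div_assoc, div_self hN.ne', mul_one]
  · filter_upwards [hB.ode] with γ ⟨h, _⟩
    exact (h.cont_mul_mul hv).sub (cv.const_smul (u γ (1 / 2) / v (1 / 2)))
  · filter_upwards [hB.ode, hB.flux_one_le] with γ ⟨h, _⟩ hC x hx
    have h1 := h.id_mul_le hC hx
    have h2 := h.id_mul_le hC (r := 1 / 2) (by norm_num)
    have hx' := Ioo_subset_Icc_self hx
    have hvx := hv.le_center hx'
    have hvn := hv.nonneg hx'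
    have hun := h.nonneg hx'
    have hu2 : 0 ≤ u γ (1 / 2) := h.nonneg (by norm_num)
    have hx0 := hx.1.le
    have hx1 := hx.2.le
    refine (abs_sub _ _).trans (add_le_add ?_ ?_)
    · rw [abs_of_nonneg (by positivity), ← mul_assoc]
      gcongr
    · rw [abs_of_nonneg (by positivity)]
      calc u γ (1 / 2) / v (1 / 2) * (x * v x ^ 2) ≤ 2 * C / v (1 / 2) * (1 * v 0 ^ 2) := by
            gcongr
            linarith
        _ = _ := by ring
  · intro x hx
    have h1 := (hB.ratio_tendsto hx).mul_const (x * v x ^ 2)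
    rw [zero_mul] at h1
    refine h1.congr fun γ => ?_
    have := hv.pos x (Ioo_subset_Ico_self hx)
    field_simp

theorem pointwise_tendsto (hB : Blowup lam1 c v q bet u p) {r : ℝ} (hr : r ∈ Ioo (0:ℝ) 1) :
    Tendsto (fun γ => u γ r) atTop (𝓝 (limRatio c v * v r)) := by
  have h1 := ((hB.ratio_tendsto hr).add hB.half_ratio_tendsto).mul_const (v r)
  rw [zero_add] at h1
  refine h1.congr fun γ => ?_
  have := hB.eigen.pos r (Ioo_subset_Ico_self hr)
  rw [sub_add_cancel]
  field_simp

theorem flux_tendsto (hB : Blowup lam1 c v q bet u p) {r : ℝ} (hr : r ∈ Ioo (0:ℝ) 1) :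
    Tendsto (fun γ => flux (p γ) r) atTop (𝓝 (limRatio c v * flux q r)) := by
  have hr' := Ioo_subset_Icc_self hr
  have hm : Tendsto (fun γ => nlMass (bet γ) (u γ) r) atTop (𝓝 0) := by
    refine squeeze_zero' ?_ ?_ hB.mass_tendsto_zero
    · filter_upwards [hB.ode] with γ ⟨h, _⟩ using h.mass_nonneg hr'
    · filter_upwards [hB.ode] with γ ⟨h, _⟩ using h.mass_mono hr'.1 hr'.2 le_rfl
  have hi := tendsto_integral_of_bdd (F := fun γ s => s * u γ s)
    (f := fun s => limRatio c v * (s * v s)) (C := fluxConst lam1 c v) ?_ ?_ ?_ hr'.1 hr'.2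
  · have h1 := hm.add ((lam_tendsto (lam1 := lam1) (c := c)).mul hi)
    have e : limRatio c v * flux q r
        = 0 + lam1 * ∫ s in (0:ℝ)..r, limRatio c v * (s * v s) := by
      rw [hB.eigen.flux_eq hr', intervalIntegral.integral_const_mul]
      simp only [nlMass, nl, zero_mul, mul_zero, intervalIntegral.integral_zero]
      ring
    rw [e]
    refine h1.congr' ?_
    filter_upwards [hB.ode] with γ ⟨h, _⟩
    rw [h.flux_eq hr']
  · filter_upwards [hB.ode] with γ ⟨h, _⟩ using h.cont_id_mul
  · filter_upwards [hB.ode, hB.flux_one_le] with γ ⟨h, _⟩ hC x hx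
    rw [abs_of_nonneg (mul_nonneg hx.1.le (h.nonneg (Ioo_subset_Icc_self hx)))]
    exact h.id_mul_le hC hx
  · intro x hx
    have := (hB.pointwise_tendsto hx).const_mul x
    rwa [show x * (limRatio c v * v x) = limRatio c v * (x * v x) by ring] at this

theorem int_sq_tendsto (hB : Blowup lam1 c v q bet u p) :
    Tendsto (fun γ => ∫ s in (0:ℝ)..1, s * u γ s ^ 2) atTop
      (𝓝 (limRatio c v ^ 2 * ∫ s in (0:ℝ)..1, s * v s ^ 2)) := by
  rw [← intervalIntegral.integral_const_mul]
  refine tendsto_integral_of_bdd (C := (2 * fluxConst lam1 c v) ^ 2) ?_ ?_ ?_ zero_le_one le_rfl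
  · filter_upwards [hB.ode] with γ ⟨h, _⟩ using continuousOn_id.mul (h.cont.pow 2)
  · filter_upwards [hB.ode, hB.flux_one_le] with γ ⟨h, _⟩ hC x hx
    rw [abs_of_nonneg (mul_nonneg hx.1.le (sq_nonneg _))]
    exact h.sq_mul_le hC hx
  · intro x hx
    have := ((hB.pointwise_tendsto hx).pow 2).const_mul x
    rwa [show x * (limRatio c v * v x) ^ 2 = limRatio c v ^ 2 * (x * v x ^ 2) by ring] at this

theorem energy_tendsto (hB : Blowup lam1 c v q bet u p) :
    Tendsto (fun γ => ∫ s in (0:ℝ)..1, s * p γ s ^ 2) atTop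
      (𝓝 (lam1 * (limRatio c v ^ 2 * ∫ s in (0:ℝ)..1, s * v s ^ 2) + 2)) := by
  refine (((lam_tendsto (c := c)).mul hB.int_sq_tendsto).add hB.self_mass_tendsto).congr' ?_
  filter_upwards [hB.ode] with γ ⟨h, _⟩ using h.energy_eq.symm

theorem weak_tendsto (hB : Blowup lam1 c v q bet u p) {ψ : ℝ → ℝ} (hψ : Continuous ψ) :
    Tendsto (fun γ => ∫ s in (0:ℝ)..1, flux (p γ) s * ψ s) atTop
      (𝓝 (∫ s in (0:ℝ)..1, limRatio c v * flux q s * ψ s)) := by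
  obtain ⟨A, hA⟩ := isCompact_Icc.exists_bound_of_continuousOn (hψ.continuousOn (s := Icc (0:ℝ) 1))
  refine tendsto_integral_of_bdd (C := fluxConst lam1 c v * A) ?_ ?_ ?_ zero_le_one le_rfl
  · filter_upwards [hB.ode] with γ ⟨h, _⟩ using h.cont_flux.mul hψ.continuousOn
  · filter_upwards [hB.ode, hB.flux_one_le] with γ ⟨h, _⟩ hC x hx
    have hx' := Ioo_subset_Icc_self hx
    rw [abs_mul, abs_of_nonneg (h.flux_nonneg hx')]
    refine mul_le_mul ((h.flux_mono hx'.1 hx'.2 le_rfl).trans hC) (hA x hx') (abs_nonneg _)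
      hB.fluxConst_pos.le
  · exact fun x hx => (hB.flux_tendsto hx).mul_const _

end Blowup

/-! ### The statement in terms of first-order quantities -/

theorem setIntegral_Ioo_eq (f : ℝ → ℝ) : ∫ r in Ioo (0:ℝ) 1, f r = ∫ r in (0:ℝ)..1, f r := by
  rw [intervalIntegral.integral_of_le zero_le_one, integral_Ioc_eq_integral_Ioo]

namespace RadODE

variable {lam bet : ℝ} {u p : ℝ → ℝ}

theorem dirEnergy_eq (h : RadODE lam bet u p) :
    dirEnergy u = 2 * π * ∫ s in (0:ℝ)..1, s * p s ^ 2 := by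
  rw [← intervalIntegral.integral_const_mul, ← setIntegral_Ioo_eq]
  refine setIntegral_congr_fun measurableSet_Ioo fun r hr => ?_
  simp only [(h.hasDerivAt r hr).deriv]
  ring

theorem pairing_eq (h : RadODE lam bet u p) (L : ℝ) (φ : ℝ → ℝ) :
    ∫ r in Ioo (0:ℝ) 1, deriv (fun t => L * u t) r * deriv φ r * (2 * π * r)
      = -(2 * π) * ∫ s in (0:ℝ)..1, L * flux p s * deriv φ s := by
  rw [← intervalIntegral.integral_const_mul, ← setIntegral_Ioo_eq]
  refine setIntegral_congr_fun measurableSet_Ioo fun r hr => ?_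
  simp only [((h.hasDerivAt r hr).const_mul L).deriv]
  unfold flux
  ring

end RadODE

theorem EigenCtx.radODE {lam1 : ℝ} {v1 : ℝ → ℝ} (hE : EigenCtx lam1 v1) :
    RadODE lam1 0 v1 (derivWithin v1 (Icc 0 1)) :=
  .of_radLap hE.1 le_rfl hE.2.1 (fun r hr => by simpa [src] using hE.2.2.1 r hr) hE.2.2.2.1
    hE.2.2.2.2.1

theorem EigenCtx.int_sq {lam1 : ℝ} {v1 : ℝ → ℝ} (hE : EigenCtx lam1 v1) :
    ∫ s in (0:ℝ)..1, s * v1 s ^ 2 = 1 / (2 * π) := by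
  have h := hE.2.2.2.2.2
  rw [setIntegral_Ioo_eq] at h
  rw [eq_div_iff (by positivity), mul_comm, ← intervalIntegral.integral_const_mul, ← h]
  congr 1 with s
  ring

theorem lamBar_eq (lam1 a l γ : ℝ) :
    lamBar lam1 a l γ = lam1 - 4 * π * a * √(lam1 / l) / γ := by
  unfold lamBar
  ring

theorem GoodFamily.blowup {lam1 : ℝ} {v1 : ℝ → ℝ} (hE : EigenCtx lam1 v1) {l : ℝ} (hl : 0 < l)
    {β : ℝ → ℝ} {u : ℝ → ℝ → ℝ} (hF : GoodFamily lam1 v1 l β u) :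
    Blowup lam1 (4 * π * v1 0 * √(lam1 / l)) v1 (derivWithin v1 (Icc 0 1)) β u
      (fun γ => derivWithin (u γ) (Icc 0 1)) := by
  have hv0 := hE.radODE.center_pos
  have hl1 := hE.1
  refine ⟨hE.radODE, by positivity, ?_⟩
  filter_upwards [Blowup.lam_tendsto.eventually_const_lt hl1, eventually_gt_atTop 0]
    with γ hlam hγ
  obtain ⟨hb, hu, hode, hpos, hbd, hc⟩ := hF γ hγ (by rwa [lamBar_eq])
  rw [lamBar_eq] at hode
  exact ⟨.of_radLap hlam hb.le hu hode hpos hbd, hc⟩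

theorem EigenCtx.limRatio_eq {lam1 : ℝ} {v1 : ℝ → ℝ} (hE : EigenCtx lam1 v1) {l : ℝ}
    (hl : 0 < l) : Blowup.limRatio (4 * π * v1 0 * √(lam1 / l)) v1 = √(l / lam1) := by
  have hv0 := hE.radODE.center_pos
  have hl1 := hE.1
  rw [Blowup.limRatio, hE.int_sq, ← inv_div lam1 l, sqrt_inv]
  have : 0 < √(lam1 / l) := sqrt_pos.2 (by positivity)
  field_simp
  ring

/-- asymptotic part of Theorem 1. As γ → +∞: β_γ → 0;
u_γ ⇀ u_∞ := √(l/λ₁) v₁ weakly in H¹₀(Ω) (bounded Dirichlet energy, and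
∫∇u_γ·∇φ → ∫∇u_∞·∇φ for all test functions φ ∈ C_c^∞(Ω)); u_∞ ≢ 0; and
∫_Ω |∇u_γ|² dy = 4π + l + o(1). -/
theorem statement6 (lam1 : ℝ) (v1 : ℝ → ℝ) (hE : EigenCtx lam1 v1) (l : ℝ) (hl : 0 < l)
    (β : ℝ → ℝ) (u : ℝ → ℝ → ℝ) (hF : GoodFamily lam1 v1 l β u) :
    Tendsto β atTop (𝓝 0) ∧
    (∃ r ∈ Set.Ico (0:ℝ) 1, Real.sqrt (l / lam1) * v1 r ≠ 0) ∧
    (∃ C : ℝ, ∀ᶠ γ in atTop, dirEnergy (u γ) ≤ C) ∧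
    (∀ φ : ℝ → ℝ, ContDiff ℝ (⊤ : ℕ∞) φ → tsupport φ ⊆ Set.Ioo (0:ℝ) 1 →
      Tendsto (fun γ : ℝ => ∫ r in Set.Ioo (0:ℝ) 1, deriv (u γ) r * deriv φ r * (2 * π * r))
        atTop
        (𝓝 (∫ r in Set.Ioo (0:ℝ) 1,
          deriv (fun t => Real.sqrt (l / lam1) * v1 t) r * deriv φ r * (2 * π * r)))) ∧
    Tendsto (fun γ : ℝ => dirEnergy (u γ)) atTop (𝓝 (4 * π + l)) := by
  have hB := hF.blowup hE hl
  have hL := hE.limRatio_eq hl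
  have hl1 := hE.1
  have hv := hE.radODE
  have henergy : Tendsto (fun γ : ℝ => dirEnergy (u γ)) atTop (𝓝 (4 * π + l)) := by
    have h1 := hB.energy_tendsto.const_mul (2 * π)
    rw [hL, hE.int_sq, sq_sqrt (by positivity)] at h1
    have e : 2 * π * (lam1 * (l / lam1 * (1 / (2 * π))) + 2) = 4 * π + l := by
      field_simp
      ring
    rw [e] at h1
    refine h1.congr' ?_
    filter_upwards [hB.ode] with γ ⟨h, _⟩ using h.dirEnergy_eq.symm
  refine ⟨hB.bet_tendsto, ⟨0, ⟨le_rfl, one_pos⟩, ?_⟩, ⟨4 * π + l + 1, ?_⟩, fun φ hφ _ => ?_,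
    henergy⟩
  · exact mul_ne_zero (sqrt_pos.2 (by positivity)).ne' hv.center_pos.ne'
  · exact henergy.eventually_le_const (lt_add_one _)
  · have h1 := (hB.weak_tendsto (hφ.continuous_deriv (by simp))).const_mul (-(2 * π))
    rw [hL, ← hv.pairing_eq] at h1
    refine h1.congr' ?_
    filter_upwards [hB.ode] with γ ⟨h, _⟩
    simpa using (h.pairing_eq 1 φ).symm

end
end

section
/- As γ → +∞ we have μ_γ γ → 0, and the rescaled functions τ_γ(y) := γ(γ − u_γ(μ_γ y)) converge to T₀(y) := log(1 + |y|²) in C²_loc(ℝ²). -/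
open Real Set Filter MeasureTheory Topology

noncomputable section

/-- `f1` and `f2` are the first and second derivatives of `f` on `[0, b]`, and `f2` is
continuous there. -/
structure HasTwoDerivs (b : ℝ) (f f1 f2 : ℝ → ℝ) : Prop where
  fst : ∀ s ∈ Icc 0 b, HasDerivWithinAt f (f1 s) (Icc 0 b) s
  snd : ∀ s ∈ Icc 0 b, HasDerivWithinAt f1 (f2 s) (Icc 0 b) s
  cont : ContinuousOn f2 (Icc 0 b)

namespace HasTwoDerivs

variable {a b : ℝ} {f f1 f2 g g1 g2 : ℝ → ℝ}

lemma continuousOn (h : HasTwoDerivs b f f1 f2) : ContinuousOn f (Icc 0 b) :=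
  fun s hs => (h.fst s hs).continuousWithinAt

lemma continuousOn_fst (h : HasTwoDerivs b f f1 f2) : ContinuousOn f1 (Icc 0 b) :=
  fun s hs => (h.snd s hs).continuousWithinAt

lemma hasDerivAt (h : HasTwoDerivs b f f1 f2) {s : ℝ} (hs : s ∈ Ioo 0 b) :
    HasDerivAt f (f1 s) s :=
  (h.fst s (Ioo_subset_Icc_self hs)).hasDerivAt (Icc_mem_nhds hs.1 hs.2)

lemma hasDerivAt_fst (h : HasTwoDerivs b f f1 f2) {s : ℝ} (hs : s ∈ Ioo 0 b) :
    HasDerivAt f1 (f2 s) s :=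
  (h.snd s (Ioo_subset_Icc_self hs)).hasDerivAt (Icc_mem_nhds hs.1 hs.2)

lemma mono (h : HasTwoDerivs b f f1 f2) (hab : a ≤ b) : HasTwoDerivs a f f1 f2 where
  fst s hs := (h.fst s ⟨hs.1, hs.2.trans hab⟩).mono (Icc_subset_Icc_right hab)
  snd s hs := (h.snd s ⟨hs.1, hs.2.trans hab⟩).mono (Icc_subset_Icc_right hab)
  cont := h.cont.mono (Icc_subset_Icc_right hab)

lemma sub (h : HasTwoDerivs b f f1 f2) (h' : HasTwoDerivs b g g1 g2) :
    HasTwoDerivs b (fun s => f s - g s) (fun s => f1 s - g1 s) (fun s => f2 s - g2 s) where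
  fst s hs := (h.fst s hs).sub (h'.fst s hs)
  snd s hs := (h.snd s hs).sub (h'.snd s hs)
  cont := h.cont.sub h'.cont

lemma const_mul (h : HasTwoDerivs b f f1 f2) (c : ℝ) :
    HasTwoDerivs b (fun s => c * f s) (fun s => c * f1 s) (fun s => c * f2 s) where
  fst s hs := (h.fst s hs).const_mul c
  snd s hs := (h.snd s hs).const_mul c
  cont := continuousOn_const.mul h.cont

lemma const_sub (h : HasTwoDerivs b f f1 f2) (c : ℝ) :
    HasTwoDerivs b (fun s => c - f s) (fun s => -f1 s) (fun s => -f2 s) where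
  fst s hs := (h.fst s hs).const_sub c
  snd s hs := (h.snd s hs).neg
  cont := h.cont.neg

lemma comp_mul (h : HasTwoDerivs b f f1 f2) {m : ℝ} (hm : 0 ≤ m) (hab : m * a ≤ b) :
    HasTwoDerivs a (fun s => f (m * s)) (fun s => m * f1 (m * s))
      (fun s => m * (m * f2 (m * s))) := by
  have hmap : MapsTo (fun s => m * s) (Icc 0 a) (Icc 0 b) := fun s hs =>
    ⟨mul_nonneg hm hs.1, (mul_le_mul_of_nonneg_left hs.2 hm).trans hab⟩
  have hd : ∀ s, HasDerivWithinAt (fun s => m * s) m (Icc 0 a) s := fun s => by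
    simpa using ((hasDerivAt_id s).const_mul m).hasDerivWithinAt
  refine ⟨fun s hs => ?_, fun s hs => ?_, ?_⟩
  · have := (h.fst _ (hmap hs)).comp s (hd s) hmap
    rwa [mul_comm] at this
  · have := ((h.snd _ (hmap hs)).comp s (hd s) hmap).const_mul m
    rwa [mul_comm (f2 _)] at this
  · exact continuousOn_const.mul (continuousOn_const.mul (h.cont.comp (by fun_prop) hmap))

/-- A bounded radial Laplacian forces the radial derivative to vanish at the origin. -/
lemma fst_zero (h : HasTwoDerivs b f f1 f2) (hb : 0 < b) {k : ℝ → ℝ}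
    (hk : ContinuousOn k (Icc 0 b)) (hode : ∀ s ∈ Ioo 0 b, f2 s + f1 s / s = k s) :
    f1 0 = 0 := by
  have h0 : (0 : ℝ) ∈ Icc 0 b := ⟨le_rfl, hb.le⟩
  have hle : 𝓝[Ioo 0 b] (0 : ℝ) ≤ 𝓝[Icc 0 b] 0 := nhdsWithin_mono _ Ioo_subset_Icc_self
  have hne : (𝓝[Ioo 0 b] (0 : ℝ)).NeBot := by
    rw [nhdsWithin_Ioo_eq_nhdsGT hb]; infer_instance
  have t1 : Tendsto f1 (𝓝[Ioo 0 b] 0) (𝓝 (f1 0)) := (h.continuousOn_fst 0 h0).mono_left hle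
  have t2 : Tendsto (fun s => s * (k s - f2 s)) (𝓝[Ioo 0 b] 0) (𝓝 (0 * (k 0 - f2 0))) :=
    ((continuousOn_id.mul (hk.sub h.cont)) 0 h0).mono_left hle
  rw [zero_mul] at t2
  refine tendsto_nhds_unique (t1.congr' ?_) t2
  filter_upwards [self_mem_nhdsWithin] with s hs
  rw [← hode s hs]
  field_simp [hs.1.ne']
  ring

lemma fst_le (h : HasTwoDerivs b f f1 f2) (h0 : f1 0 = 0) {c : ℝ}
    (hode : ∀ s ∈ Ioo 0 b, f2 s + f1 s / s ≤ c) {s : ℝ} (hs : s ∈ Icc 0 b) :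
    f1 s ≤ c / 2 * s := by
  have hanti : AntitoneOn (fun s => s * f1 s - c / 2 * s ^ 2) (Icc 0 b) := by
    refine antitoneOn_of_hasDerivWithinAt_nonpos (f' := fun s => f1 s + s * f2 s - c * s)
      (convex_Icc 0 b) ?_ ?_ ?_
    · exact (continuousOn_id.mul h.continuousOn_fst).sub (by fun_prop)
    · intro x hx
      rw [interior_Icc] at hx
      have := (((hasDerivAt_id x).mul (h.hasDerivAt_fst hx)).sub
        ((hasDerivAt_pow 2 x).const_mul (c / 2))).hasDerivWithinAt (s := interior (Icc 0 b))
      refine this.congr_deriv ?_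
      simp; ring
    · intro x hx
      rw [interior_Icc] at hx
      have h1 := mul_le_mul_of_nonneg_left (hode x hx) hx.1.le
      have h2 : x * (f2 x + f1 x / x) = f1 x + x * f2 x := by
        field_simp [hx.1.ne']; ring
      linarith
  rcases hs.1.eq_or_lt with h | hpos
  · rw [← h, h0]; simp
  · have := hanti ⟨le_rfl, hs.1.trans hs.2⟩ hs hs.1
    simp only [zero_mul, ne_eq, OfNat.ofNat_ne_zero, not_false_eq_true, zero_pow, mul_zero,
      sub_zero] at this
    nlinarith

lemma le_of_fst_le (h : HasTwoDerivs b f f1 f2) {c : ℝ}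
    (hle : ∀ s ∈ Icc 0 b, f1 s ≤ c / 2 * s) {s : ℝ} (hs : s ∈ Icc 0 b) :
    f s ≤ f 0 + c / 4 * s ^ 2 := by
  have hanti : AntitoneOn (fun s => f s - c / 4 * s ^ 2) (Icc 0 b) := by
    refine antitoneOn_of_hasDerivWithinAt_nonpos (f' := fun s => f1 s - c / 2 * s)
      (convex_Icc 0 b) (h.continuousOn.sub (by fun_prop)) ?_ ?_
    · intro x hx
      rw [interior_Icc] at hx
      have := ((h.hasDerivAt hx).sub
        ((hasDerivAt_pow 2 x).const_mul (c / 4))).hasDerivWithinAt (s := interior (Icc 0 b))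
      refine this.congr_deriv ?_
      simp; ring
    · intro x hx
      linarith [hle x (interior_subset hx)]
  have := hanti ⟨le_rfl, hs.1.trans hs.2⟩ hs hs.1
  simp only [ne_eq, OfNat.ofNat_ne_zero, not_false_eq_true, zero_pow, mul_zero, sub_zero] at this
  linarith

lemma antitoneOn (h : HasTwoDerivs b f f1 f2) (hle : ∀ s ∈ Icc 0 b, f1 s ≤ 0) :
    AntitoneOn f (Icc 0 b) :=
  antitoneOn_of_hasDerivWithinAt_nonpos (convex_Icc 0 b) h.continuousOn
    (fun x hx => (h.hasDerivAt (by rwa [interior_Icc] at hx)).hasDerivWithinAt)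
    (fun x hx => hle x (interior_subset hx))

lemma iteratedDerivWithin_Ici (h : HasTwoDerivs b f f1 f2) {s : ℝ} (hs : s ∈ Ico 0 b) :
    iteratedDerivWithin 1 f (Ici 0) s = f1 s ∧ iteratedDerivWithin 2 f (Ici 0) s = f2 s := by
  have hnhds : ∀ t ∈ Ico 0 b, Icc 0 b ∈ 𝓝[Ici 0] t := fun t ht => by
    rw [← Ici_inter_Iic]
    exact inter_mem self_mem_nhdsWithin (mem_nhdsWithin_of_mem_nhds (Iic_mem_nhds ht.2))
  have hu : ∀ t ∈ Ico 0 b, UniqueDiffWithinAt ℝ (Ici (0 : ℝ)) t := fun t ht =>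
    uniqueDiffOn_Ici 0 t ht.1
  have h1 : ∀ t ∈ Ico 0 b, iteratedDerivWithin 1 f (Ici 0) t = f1 t := fun t ht => by
    rw [iteratedDerivWithin_one]
    exact ((h.fst t (Ico_subset_Icc_self ht)).mono_of_mem_nhdsWithin (hnhds t ht)).derivWithin
      (hu t ht)
  refine ⟨h1 s hs, ?_⟩
  rw [show (2 : ℕ) = 1 + 1 from rfl, iteratedDerivWithin_succ]
  have hev : iteratedDerivWithin 1 f (Ici 0) =ᶠ[𝓝[Ici 0] s] f1 := by
    filter_upwards [self_mem_nhdsWithin, mem_nhdsWithin_of_mem_nhds (Iio_mem_nhds hs.2)]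
      with t ht ht'
    exact h1 t ⟨ht, ht'⟩
  rw [hev.derivWithin_eq (h1 s hs)]
  exact ((h.snd s (Ico_subset_Icc_self hs)).mono_of_mem_nhdsWithin (hnhds s hs)).derivWithin
    (hu s hs)

/-- A Grönwall estimate for the radial Laplacian. -/
lemma gronwall (h : HasTwoDerivs b f f1 f2) (hb : 0 < b) (hf0 : f 0 = 0) (hf1 : f1 0 = 0)
    {L η : ℝ} (hL : 0 ≤ L) (hη : 0 ≤ η)
    (hode : ∀ s ∈ Ioo 0 b, |f2 s + f1 s / s| ≤ η + L * |f s|) {s : ℝ} (hs : s ∈ Icc 0 b) :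
    |f s| ≤ exp ((2 + L) * b) * η ∧ |f1 s| ≤ exp ((2 + L) * b) * η ∧
      |f2 s| ≤ 2 * (1 + L * exp ((2 + L) * b)) * η := by
  set K := 2 + L with hK
  have hKpos : 1 ≤ K := by linarith
  set B := exp (K * b) with hB
  have hB1 : 1 ≤ B := one_le_exp (by positivity)
  have hanti : AntitoneOn (fun s => (f s ^ 2 + f1 s ^ 2 + η ^ 2) * exp (-(K * s))) (Icc 0 b) := by
    refine antitoneOn_of_hasDerivWithinAt_nonpos
      (f' := fun s => (2 * f s * f1 s + 2 * f1 s * f2 s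
        - K * (f s ^ 2 + f1 s ^ 2 + η ^ 2)) * exp (-(K * s)))
      (convex_Icc 0 b) ?_ ?_ ?_
    · exact (((h.continuousOn.pow 2).add (h.continuousOn_fst.pow 2)).add continuousOn_const).mul
        (by fun_prop)
    · intro x hx
      rw [interior_Icc] at hx
      have he : HasDerivAt (fun s => exp (-(K * s))) (exp (-(K * x)) * (-(K * 1))) x :=
        (((hasDerivAt_id x).const_mul K).neg).exp
      have := (((((h.hasDerivAt hx).pow 2).add ((h.hasDerivAt_fst hx).pow 2)).add_const
        (η ^ 2)).mul he).hasDerivWithinAt (s := interior (Icc 0 b))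
      refine this.congr_deriv ?_
      simp; ring
    · intro x hx
      rw [interior_Icc] at hx
      refine mul_nonpos_of_nonpos_of_nonneg ?_ (exp_pos _).le
      have h1 : f1 x * f2 x ≤ |f1 x| * (η + L * |f x|) := by
        have e1 : f1 x * f2 x = f1 x * (f2 x + f1 x / x) - f1 x ^ 2 / x := by ring
        have e2 : 0 ≤ f1 x ^ 2 / x := div_nonneg (sq_nonneg _) hx.1.le
        have e3 : f1 x * (f2 x + f1 x / x) ≤ |f1 x| * |f2 x + f1 x / x| := by
          rw [← abs_mul]; exact le_abs_self _
        have e4 := mul_le_mul_of_nonneg_left (hode x hx) (abs_nonneg (f1 x))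
        linarith
      have h2 : f x * f1 x ≤ |f x| * |f1 x| := by rw [← abs_mul]; exact le_abs_self _
      rw [← sq_abs (f x), ← sq_abs (f1 x), hK]
      nlinarith [mul_nonneg hL (sq_nonneg (|f x| - |f1 x|)), sq_nonneg (|f x| - |f1 x|),
        sq_nonneg (|f1 x| - η), mul_nonneg hL (sq_nonneg η), sq_nonneg (|f x|), sq_nonneg η]
  have hE : ∀ s ∈ Icc 0 b, f s ^ 2 + f1 s ^ 2 ≤ (B * η) ^ 2 := fun s hs => by
    have h1 := hanti ⟨le_rfl, hb.le⟩ hs hs.1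
    simp only [hf0, hf1, mul_zero, neg_zero, exp_zero, exp_neg] at h1
    rw [← div_eq_mul_inv, div_le_iff₀ (exp_pos _)] at h1
    have h2 : exp (K * s) ≤ B := exp_le_exp.2 (mul_le_mul_of_nonneg_left hs.2 (by linarith))
    have h3 : η ^ 2 * exp (K * s) ≤ η ^ 2 * B := mul_le_mul_of_nonneg_left h2 (sq_nonneg η)
    nlinarith [mul_nonneg (sq_nonneg η) (by nlinarith : 0 ≤ B ^ 2 - B)]
  have hbd : ∀ s ∈ Icc 0 b, |f s| ≤ B * η := fun s hs =>
    abs_le_of_sq_le_sq (by nlinarith [hE s hs, sq_nonneg (f1 s)]) (by positivity)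
  have hbd1 : ∀ s ∈ Icc 0 b, |f1 s| ≤ B * η := fun s hs =>
    abs_le_of_sq_le_sq (by nlinarith [hE s hs, sq_nonneg (f s)]) (by positivity)
  have hH : ∀ s ∈ Ioo 0 b, |f2 s + f1 s / s| ≤ (1 + L * B) * η := fun s hs => by
    nlinarith [hode s hs, mul_le_mul_of_nonneg_left (hbd s (Ioo_subset_Icc_self hs)) hL]
  refine ⟨hbd s hs, hbd1 s hs, ?_⟩
  have hopen : ∀ t ∈ Ioo 0 b, |f2 t| ≤ 2 * (1 + L * B) * η := fun t ht => by
    have u1 := h.fst_le hf1 (fun s hs => (abs_le.1 (hH s hs)).2) (Ioo_subset_Icc_self ht)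
    have u2 := (h.const_mul (-1)).fst_le (c := (1 + L * B) * η) (by simp [hf1]) (fun s hs => by
      have := (abs_le.1 (hH s hs)).1
      have e : -1 * f2 s + -1 * f1 s / s = -(f2 s + f1 s / s) := by ring
      rw [e]; linarith) (Ioo_subset_Icc_self ht)
    have u3 : f1 t / t ≤ (1 + L * B) * η / 2 := by rw [div_le_iff₀ ht.1]; linarith
    have u4 : -((1 + L * B) * η / 2) ≤ f1 t / t := by rw [le_div_iff₀ ht.1]; linarith
    have u5 := abs_le.1 (hH t ht)
    have : 0 ≤ (1 + L * B) * η := by positivity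
    rw [abs_le]; constructor <;> linarith [u5.1, u5.2]
  have hcl : s ∈ closure (Ioo 0 b) := by rwa [closure_Ioo hb.ne]
  exact ContinuousWithinAt.closure_le hcl
    ((h.cont.abs s hs).mono Ioo_subset_Icc_self) continuousWithinAt_const hopen

end HasTwoDerivs

lemma ContDiffOn.exists_hasTwoDerivs {f : ℝ → ℝ} (hf : ContDiffOn ℝ (⊤ : ℕ∞) f (Icc 0 1)) :
    ∃ f1 f2, HasTwoDerivs 1 f f1 f2 ∧
      ∀ r ∈ Ioo (0 : ℝ) 1, radLap f r = -(f2 r + f1 r / r) := by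
  have hu : UniqueDiffOn ℝ (Icc (0 : ℝ) 1) := uniqueDiffOn_Icc one_pos
  have hf1 : ContDiffOn ℝ 1 (derivWithin f (Icc 0 1)) (Icc 0 1) :=
    hf.derivWithin hu (by norm_cast)
  have H : HasTwoDerivs 1 f (derivWithin f (Icc 0 1))
      (derivWithin (derivWithin f (Icc 0 1)) (Icc 0 1)) :=
    ⟨fun s hs => ((hf.differentiableOn (by simp)) s hs).hasDerivWithinAt,
      fun s hs => ((hf1.differentiableOn (by simp)) s hs).hasDerivWithinAt,
      hf1.continuousOn_derivWithin hu le_rfl⟩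
  refine ⟨_, _, H, fun r hr => ?_⟩
  have hev : deriv f =ᶠ[𝓝 r] derivWithin f (Icc 0 1) := by
    filter_upwards [Ioo_mem_nhds hr.1 hr.2] with t ht
    exact (H.hasDerivAt ht).deriv
  rw [radLap, hev.deriv_eq, (H.hasDerivAt_fst hr).deriv, (H.hasDerivAt hr).deriv]
  ring

lemma EigenCtx.isRadSol {lam1 : ℝ} {v1 : ℝ → ℝ} (h : EigenCtx lam1 v1) :
    IsRadSol lam1 0 (v1 0) v1 :=
  ⟨h.2.1, fun r hr => by rw [h.2.2.1 r hr]; ring, h.2.2.2.1, h.2.2.2.2.1, rfl⟩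

lemma IsRadSol.nonneg {lam β γ : ℝ} {u : ℝ → ℝ} (h : IsRadSol lam β γ u) {r : ℝ}
    (hr : r ∈ Icc (0 : ℝ) 1) : 0 ≤ u r := by
  rcases hr.2.eq_or_lt with h1 | h1
  · rw [h1, h.2.2.2.1]
  · exact (h.2.2.1 r ⟨hr.1, h1⟩).le

lemma IsRadSol.exists_hasTwoDerivs {lam β γ : ℝ} {u : ℝ → ℝ} (hlam : 0 ≤ lam) (hβ : 0 ≤ β)
    (h : IsRadSol lam β γ u) :
    ∃ u1 u2, HasTwoDerivs 1 u u1 u2 ∧ u1 0 = 0 ∧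
      (∀ r ∈ Ioo (0 : ℝ) 1, u2 r + u1 r / r = -((lam + β * exp (u r ^ 2)) * u r)) ∧
      AntitoneOn u (Icc 0 1) := by
  obtain ⟨u1, u2, hd, hlap⟩ := h.1.exists_hasTwoDerivs
  have hode : ∀ r ∈ Ioo (0 : ℝ) 1,
      u2 r + u1 r / r = -((lam + β * exp (u r ^ 2)) * u r) := fun r hr => by
    linarith [hlap r hr, h.2.1 r hr]
  have hu := hd.continuousOn
  have h0 : u1 0 = 0 := hd.fst_zero one_pos
    (k := fun r => -((lam + β * exp (u r ^ 2)) * u r)) (by fun_prop) hode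
  refine ⟨u1, u2, hd, h0, hode, hd.antitoneOn fun s hs => ?_⟩
  have := hd.fst_le (c := 0) h0 (fun r hr => by
    have := h.nonneg (Ioo_subset_Icc_self hr)
    rw [hode r hr]
    have : 0 ≤ (lam + β * exp (u r ^ 2)) * u r := by positivity
    linarith) hs
  linarith

lemma IsRadSol.le_of_beta_mul_exp_le {lam1 lam β γ C : ℝ} {u : ℝ → ℝ} (hlam1 : 0 < lam1)
    (hu : IsRadSol lam β γ u) (hγ : 0 < γ) (hβ : 0 ≤ β)
    (hlam : lam1 / 2 ≤ lam) (hlam' : lam ≤ lam1) (hC : 0 ≤ C) (hβC : β * exp (γ ^ 2) ≤ C)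
    {r₀ : ℝ} (hr₀ : r₀ = 1 / (2 + lam1 + C)) :
    (∀ s ∈ Icc 0 r₀, γ / 2 ≤ u s) ∧
      ∀ s ∈ Icc (0 : ℝ) 1, u s ≤ γ * (1 - lam1 * r₀ ^ 2 / 16 * s ^ 2) := by
  obtain ⟨u', u'', hud, hu0, huode, huanti⟩ :=
    hu.exists_hasTwoDerivs (by linarith : (0 : ℝ) ≤ lam) hβ
  have h01 : (0 : ℝ) ∈ Icc (0 : ℝ) 1 := ⟨le_rfl, zero_le_one⟩
  have hr₀pos : 0 < r₀ := by rw [hr₀]; positivity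
  have hr₀half : r₀ ≤ 1 / 2 := by
    rw [hr₀]; exact one_div_le_one_div_of_le two_pos (by linarith)
  have hr₀mem : r₀ ∈ Icc (0 : ℝ) 1 := ⟨hr₀pos.le, by linarith⟩
  have hKr₀ : (lam1 + C) * r₀ ≤ 1 := by
    rw [hr₀, mul_one_div, div_le_one (by positivity)]; linarith
  have huγ : u 0 = γ := hu.2.2.2.2
  have hule : ∀ s ∈ Icc (0 : ℝ) 1, u s ≤ γ := fun s hs => huγ ▸ huanti h01 hs hs.1
  obtain ⟨V, hV⟩ : ∃ V : ℝ → ℝ, V = fun s => lam + β * exp (u s ^ 2) := ⟨_, rfl⟩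
  have hode : ∀ s ∈ Ioo (0 : ℝ) 1, u'' s + u' s / s = -(V s * u s) := by rwa [hV]
  have hVlow : ∀ s, lam1 / 2 ≤ V s := fun s => by
    have : 0 ≤ β * exp (u s ^ 2) := by positivity
    rw [hV]; linarith
  have hVup : ∀ s ∈ Icc (0 : ℝ) 1, V s ≤ lam1 + C := fun s hs => by
    have h2 : exp (u s ^ 2) ≤ exp (γ ^ 2) :=
      exp_le_exp.2 (pow_le_pow_left₀ (hu.nonneg hs) (hule s hs) 2)
    have h3 := mul_le_mul_of_nonneg_left h2 hβ
    rw [hV]; linarith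
  have hhalf : ∀ s ∈ Icc 0 r₀, γ / 2 ≤ u s := fun s hs => by
    have hd := hud.const_sub γ
    have hs1 : s ∈ Icc (0 : ℝ) 1 := ⟨hs.1, hs.2.trans hr₀mem.2⟩
    have h1 := hd.le_of_fst_le (c := (lam1 + C) * γ) (fun t ht => hd.fst_le (by simp [hu0])
      (fun r hr => by
        have hr' := Ioo_subset_Icc_self hr
        have e : -u'' r + -u' r / r = V r * u r := by
          linear_combination -(hode r hr)
        rw [e]
        exact mul_le_mul (hVup r hr') (hule r hr') (hu.nonneg hr') (by positivity)) ht) hs1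
    simp only [huγ] at h1
    have h2 : (lam1 + C) * s ^ 2 ≤ 1 := by
      have : s ^ 2 ≤ r₀ * 1 := by nlinarith [hs.1, hs.2, hr₀mem.2]
      nlinarith
    nlinarith
  have hsmall : ∀ s ∈ Icc 0 r₀, u s ≤ γ * (1 - lam1 / 16 * s ^ 2) := fun s hs => by
    have hd := hud.mono hr₀mem.2
    have h1 := hd.le_of_fst_le (c := -(lam1 / 4 * γ)) (fun t ht => hd.fst_le hu0
      (fun r hr => by
        rw [hode r ⟨hr.1, hr.2.trans_le hr₀mem.2⟩]
        nlinarith [hVlow r, hhalf r (Ioo_subset_Icc_self hr)]) ht) hs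
    rw [huγ] at h1
    linarith
  refine ⟨hhalf, fun s hs => ?_⟩
  rcases le_total s r₀ with hsr | hsr
  · refine (hsmall s ⟨hs.1, hsr⟩).trans ?_
    have h1 : r₀ ^ 2 ≤ 1 := by nlinarith [hr₀mem.2]
    have h2 : lam1 * r₀ ^ 2 / 16 ≤ lam1 / 16 := by nlinarith
    gcongr
  · refine (huanti hr₀mem hs hsr).trans ((hsmall r₀ ⟨hr₀pos.le, le_rfl⟩).trans ?_)
    have h3 : s ^ 2 ≤ 1 := by nlinarith [hs.1, hs.2]
    have h4 : lam1 * r₀ ^ 2 / 16 * s ^ 2 ≤ lam1 * r₀ ^ 2 / 16 * 1 :=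
      mul_le_mul_of_nonneg_left h3 (by positivity)
    refine mul_le_mul_of_nonneg_left ?_ hγ.le
    linarith

/-- Testing the equation against the first eigenfunction: if `β exp (γ ^ 2)` is bounded,
the spectral gap `lam1 - lam` is `O(γ⁻²)`. -/
lemma spectral_gap_le {lam1 lam β γ C M m : ℝ} {v u : ℝ → ℝ} (hlam1 : 0 < lam1)
    (hv : IsRadSol lam1 0 M v) (hu : IsRadSol lam β γ u) (hγ : 0 < γ) (hβ : 0 ≤ β)
    (hlam : lam1 / 2 ≤ lam) (hlam' : lam ≤ lam1) (hC : 0 ≤ C) (hβC : β * exp (γ ^ 2) ≤ C)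
    (hmv : ∀ r ∈ Icc (0 : ℝ) (1 / 2), m ≤ v r) {r₀ c : ℝ}
    (hr₀ : r₀ = 1 / (2 + lam1 + C)) (hc : c = lam1 * r₀ ^ 2 / 16) :
    (lam1 - lam) * m * r₀ ^ 2 / 4 ≤ C * M / (2 * (c * γ ^ 2)) := by
  obtain ⟨hhalf, hdecay⟩ := hu.le_of_beta_mul_exp_le hlam1 hγ hβ hlam hlam' hC hβC hr₀
  rw [← hc] at hdecay
  obtain ⟨v', v'', hvd, hv0, hvode, hvanti⟩ := hv.exists_hasTwoDerivs hlam1.le le_rfl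
  obtain ⟨u', u'', hud, hu0, huode, huanti⟩ :=
    hu.exists_hasTwoDerivs (by linarith : (0 : ℝ) ≤ lam) hβ
  have h01 : (0 : ℝ) ∈ Icc (0 : ℝ) 1 := ⟨le_rfl, zero_le_one⟩
  have h11 : (1 : ℝ) ∈ Icc (0 : ℝ) 1 := ⟨zero_le_one, le_rfl⟩
  have hr₀pos : 0 < r₀ := by rw [hr₀]; positivity
  have hr₀half : r₀ ≤ 1 / 2 := by
    rw [hr₀]; exact one_div_le_one_div_of_le two_pos (by linarith)
  have hr₀mem : r₀ ∈ Icc (0 : ℝ) 1 := ⟨hr₀pos.le, by linarith⟩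
  have hcpos : 0 < c := by rw [hc]; positivity
  have hgap : 0 ≤ lam1 - lam := by linarith
  have hvM : ∀ s ∈ Icc (0 : ℝ) 1, v s ≤ M := fun s hs => hv.2.2.2.2 ▸ hvanti h01 hs hs.1
  have hule : ∀ s ∈ Icc (0 : ℝ) 1, u s ≤ γ := fun s hs => hu.2.2.2.2 ▸ huanti h01 hs hs.1
  obtain ⟨E, hEdef⟩ : ∃ E : ℝ → ℝ, E = fun s => β * exp (u s ^ 2) := ⟨_, rfl⟩
  have hode : ∀ s ∈ Ioo (0 : ℝ) 1, u'' s + u' s / s = -((lam + E s) * u s) := by rwa [hEdef]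
  have hEnn : ∀ s, 0 ≤ E s := fun s => by rw [hEdef]; positivity
  obtain ⟨a, ha⟩ : ∃ a, a = c * γ ^ 2 := ⟨_, rfl⟩
  have hapos : 0 < a := by rw [ha]; positivity
  have hexp : ∀ s ∈ Icc (0 : ℝ) 1, E s ≤ C * exp (-(a * s ^ 2)) := fun s hs => by
    have h1 : u s ^ 2 ≤ γ ^ 2 + -(a * s ^ 2) := by
      have h2 : u s ^ 2 ≤ γ * u s := by nlinarith [hu.nonneg hs, hule s hs]
      have h3 := mul_le_mul_of_nonneg_left (hdecay s hs) hγ.le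
      rw [ha]; linarith
    calc E s = β * exp (u s ^ 2) := by rw [hEdef]
      _ ≤ β * exp (γ ^ 2 + -(a * s ^ 2)) := mul_le_mul_of_nonneg_left (exp_le_exp.2 h1) hβ
      _ = β * exp (γ ^ 2) * exp (-(a * s ^ 2)) := by rw [exp_add]; ring
      _ ≤ _ := mul_le_mul_of_nonneg_right hβC (exp_pos _).le
  have hMnn : 0 ≤ M := (hv.nonneg h01).trans (hvM 0 h01)
  obtain ⟨D, hD⟩ : ∃ D, D = C * (M * γ) / (2 * a) := ⟨_, rfl⟩
  have hDnn : 0 ≤ D := by rw [hD]; positivity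
  obtain ⟨P, hP⟩ : ∃ P : ℝ → ℝ,
    P = fun s => s * (u s * v' s - u' s * v s) + D * exp (-(a * s ^ 2)) := ⟨_, rfl⟩
  have hPc : ContinuousOn P (Icc 0 1) := by
    have := hud.continuousOn
    have := hud.continuousOn_fst
    have := hvd.continuousOn
    have := hvd.continuousOn_fst
    rw [hP]; fun_prop
  have hPd : ∀ s ∈ Ioo (0 : ℝ) 1, ∃ p, HasDerivAt P p s ∧
      p ≤ -((lam1 - lam) * (v s * u s) * s) := fun s hs => by
    have hs' := Ioo_subset_Icc_self hs
    rw [hP]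
    refine ⟨_, ((hasDerivAt_id s).mul (((hud.hasDerivAt hs).mul (hvd.hasDerivAt_fst hs)).sub
      ((hud.hasDerivAt_fst hs).mul (hvd.hasDerivAt hs)))).add
      (((((hasDerivAt_pow 2 s).const_mul a).neg).exp).const_mul D), ?_⟩
    have e3 : u'' s = -((lam + E s) * u s) - u' s / s := by linarith [hode s hs]
    have e4 : v'' s = -(lam1 * v s) - v' s / s := by linarith [hvode s hs]
    have e5 : D * (2 * a) = C * (M * γ) := by rw [hD]; field_simp
    have e6 : v s * u s * E s ≤ M * γ * (C * exp (-(a * s ^ 2))) :=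
      mul_le_mul (mul_le_mul (hvM s hs') (hule s hs') (hu.nonneg hs') hMnn) (hexp s hs')
        (hEnn s) (by positivity)
    have e7 := mul_le_mul_of_nonneg_right e6 hs.1.le
    have e8 : s / s = 1 := div_self hs.1.ne'
    have key : 1 * (u s * v' s - u' s * v s) + s * (u' s * v' s + u s * v'' s -
          (u'' s * v s + u' s * v' s)) + D * (exp (-(a * s ^ 2)) * -(a * (2 * s)))
        = -((lam1 - lam) * (v s * u s) * s) + v s * u s * E s * s
          - D * (2 * a) * exp (-(a * s ^ 2)) * s := by
      rw [e3, e4]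
      linear_combination (u' s * v s - u s * v' s) * e8
    rw [e5] at key
    simp only [id, Nat.cast_ofNat, Nat.add_one_sub_one, pow_one, Pi.mul_apply, Pi.sub_apply,
      Pi.neg_apply]
    linarith
  choose! p hp hple using hPd
  have hanti : AntitoneOn P (Icc 0 1) := by
    refine antitoneOn_of_hasDerivWithinAt_nonpos (f' := p) (convex_Icc 0 1) hPc
      (fun s hs => (hp s (by rwa [interior_Icc] at hs)).hasDerivWithinAt) (fun s hs => ?_)
    rw [interior_Icc] at hs
    have hs' := Ioo_subset_Icc_self hs
    refine (hple s hs).trans (neg_nonpos.2 ?_)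
    exact mul_nonneg (mul_nonneg hgap (mul_nonneg (hv.nonneg hs') (hu.nonneg hs'))) hs.1.le
  have hanti' : AntitoneOn (fun s => P s + (lam1 - lam) * (m * γ) / 4 * s ^ 2) (Icc 0 r₀) := by
    refine antitoneOn_of_hasDerivWithinAt_nonpos
      (f' := fun s => p s + (lam1 - lam) * (m * γ) / 4 * (2 * s)) (convex_Icc 0 r₀)
      ((hPc.mono (Icc_subset_Icc_right hr₀mem.2)).add (by fun_prop))
      (fun s hs => ?_) (fun s hs => ?_) <;> rw [interior_Icc] at hs
    · have := ((hp s ⟨hs.1, hs.2.trans_le hr₀mem.2⟩).add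
        ((hasDerivAt_pow 2 s).const_mul ((lam1 - lam) * (m * γ) / 4))).hasDerivWithinAt
        (s := interior (Icc 0 r₀))
      refine this.congr_deriv ?_
      simp
    · have h1 := hple s ⟨hs.1, hs.2.trans_le hr₀mem.2⟩
      have h2 : m * (γ / 2) ≤ v s * u s :=
        mul_le_mul (hmv s ⟨hs.1.le, hs.2.le.trans hr₀half⟩) (hhalf s (Ioo_subset_Icc_self hs))
          (by positivity) (hv.nonneg ⟨hs.1.le, hs.2.le.trans hr₀mem.2⟩)
      have h3 := mul_le_mul_of_nonneg_right (mul_le_mul_of_nonneg_left h2 hgap) hs.1.le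
      linarith
  have i1 := hanti hr₀mem h11 hr₀mem.2
  have i2 := hanti' ⟨le_rfl, hr₀pos.le⟩ ⟨hr₀pos.le, le_rfl⟩ hr₀pos.le
  have i3 : 0 ≤ P 1 := by
    have : 0 ≤ D * exp (-(a * 1 ^ 2)) := by positivity
    simp only [hP, hu.2.2.2.1, hv.2.2.2.1]
    linarith
  have i4 : P 0 = D := by simp [hP]
  simp only [i4, hD, ha] at i2
  have i5 : (lam1 - lam) * m * r₀ ^ 2 / 4 * γ ≤ C * M / (2 * (c * γ ^ 2)) * γ := by
    have : C * (M * γ) / (2 * (c * γ ^ 2)) = C * M / (2 * (c * γ ^ 2)) * γ := by ring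
    linarith
  exact le_of_mul_le_mul_right i5 hγ

lemma tendsto_lamBar (lam1 v10 l : ℝ) : Tendsto (lamBar lam1 v10 l) atTop (𝓝 lam1) := by
  have h : Tendsto (fun γ : ℝ => lam1 - 4 * π * v10 / γ * √(lam1 / l)) atTop
      (𝓝 (lam1 - 0 * √(lam1 / l))) :=
    ((tendsto_const_nhds.div_atTop tendsto_id).mul_const _).const_sub _
  rw [zero_mul, sub_zero] at h
  exact h

lemma GoodFamily.tendsto_beta_mul_exp {lam1 l : ℝ} {v1 β : ℝ → ℝ} {u : ℝ → ℝ → ℝ}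
    (hE : EigenCtx lam1 v1) (hl : 0 < l) (hF : GoodFamily lam1 v1 l β u) :
    Tendsto (fun γ => β γ * exp (γ ^ 2)) atTop atTop := by
  have hlam1 := hE.1
  have hv := hE.isRadSol
  have hv0 : 0 < v1 0 := hv.2.2.1 0 ⟨le_rfl, one_pos⟩
  refine tendsto_atTop.2 fun C₀ => ?_
  set C := max C₀ 1
  have hC : 0 < C := lt_max_of_lt_right one_pos
  obtain ⟨m, hm, hmv⟩ : ∃ m > 0, ∀ r ∈ Icc (0 : ℝ) (1 / 2), m ≤ v1 r := by
    obtain ⟨r, hr, hmin⟩ := isCompact_Icc.exists_isMinOn (s := Icc (0 : ℝ) (1 / 2))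
      (nonempty_Icc.2 (by norm_num))
      (hv.1.continuousOn.mono (Icc_subset_Icc_right (by norm_num)))
    exact ⟨v1 r, hv.2.2.1 r ⟨hr.1, by linarith [hr.2]⟩, fun t ht => hmin ht⟩
  set r₀ := 1 / (2 + lam1 + C) with hr₀
  set c := lam1 * r₀ ^ 2 / 16 with hc
  have hr₀pos : 0 < r₀ := by positivity
  have hcpos : 0 < c := by positivity
  set q := 4 * π * v1 0 * √(lam1 / l) with hq
  have hqpos : 0 < q := by positivity
  filter_upwards [eventually_gt_atTop 0,
    eventually_gt_atTop (C * v1 0 / (2 * c) / (q * m * r₀ ^ 2 / 4)),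
    (tendsto_lamBar lam1 (v1 0) l).eventually (lt_mem_nhds (half_lt_self hlam1))] with γ hγ hγ' hlam
  obtain ⟨hβ, hu⟩ := hF γ hγ ((half_pos hlam1).trans hlam)
  by_contra! hcon
  have hgap : lam1 - lamBar lam1 (v1 0) l γ = q / γ := by rw [lamBar, hq]; ring
  have hle := spectral_gap_le hlam1 hv hu hγ hβ.le hlam.le
    (by have : 0 < q / γ := by positivity
        linarith) hC.le (hcon.le.trans (le_max_left _ _)) hmv hr₀ hc
  rw [hgap] at hle
  rw [div_lt_iff₀ (by positivity), div_lt_iff₀ (by positivity)] at hγ'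
  rw [le_div_iff₀ (by positivity)] at hle
  have e : q / γ * m * r₀ ^ 2 / 4 * (2 * (c * γ ^ 2)) = γ * (q * m * r₀ ^ 2 / 4) * (2 * c) := by
    field_simp
  linarith

lemma hasTwoDerivs_log_one_add_sq (b : ℝ) :
    HasTwoDerivs b (fun s => log (1 + s ^ 2)) (fun s => 2 * s / (1 + s ^ 2))
      (fun s => (2 * (1 + s ^ 2) - 2 * s * (2 * s)) / (1 + s ^ 2) ^ 2) := by
  have hpos : ∀ s : ℝ, 1 + s ^ 2 ≠ 0 := fun s => by positivity
  have hd : ∀ s : ℝ, HasDerivAt (fun s : ℝ => 1 + s ^ 2) (2 * s) s := fun s => by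
    simpa using (hasDerivAt_pow 2 s).const_add 1
  have hd2 : ∀ s : ℝ, HasDerivAt (fun s : ℝ => 2 * s) 2 s := fun s => by
    simpa using (hasDerivAt_id s).const_mul 2
  refine ⟨fun s _ => ((hd s).log (hpos s)).hasDerivWithinAt,
    fun s _ => ((hd2 s).div (hd s) (hpos s)).hasDerivWithinAt, ?_⟩
  exact ContinuousOn.div (by fun_prop) (by fun_prop) fun s _ => pow_ne_zero 2 (hpos s)

/-- `log (1 + |y| ^ 2)` solves the Liouville equation `-Δ T = 4 exp (-2 T)`. -/
lemma liouville_log_one_add_sq {s : ℝ} (hs : s ≠ 0) :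
    (2 * (1 + s ^ 2) - 2 * s * (2 * s)) / (1 + s ^ 2) ^ 2 + 2 * s / (1 + s ^ 2) / s
      = 4 * exp (-2 * log (1 + s ^ 2)) := by
  have hpos : 0 < 1 + s ^ 2 := by positivity
  have : exp (-2 * log (1 + s ^ 2)) = ((1 + s ^ 2) ^ 2)⁻¹ := by
    rw [show -2 * log (1 + s ^ 2) = -(log (1 + s ^ 2) + log (1 + s ^ 2)) by ring, exp_neg,
      exp_add, exp_log hpos]
    ring
  rw [this]
  field_simp
  ring

lemma IsRadSol.exists_hasTwoDerivs_rescaled {lam β γ μ b : ℝ} {u : ℝ → ℝ} (hlam : 0 ≤ lam)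
    (hβ : 0 ≤ β) (hγ : 0 < γ) (hμ : 0 < μ) (hμγ : β * γ ^ 2 * exp (γ ^ 2) * μ ^ 2 = 4)
    (hμb : μ * b ≤ 1) (h : IsRadSol lam β γ u) {τ : ℝ → ℝ}
    (hτ : τ = fun s => γ * (γ - u (μ * s))) :
    ∃ τ1 τ2, HasTwoDerivs b τ τ1 τ2 ∧ τ1 0 = 0 ∧
      (∀ s ∈ Icc 0 b, 0 ≤ τ s ∧ τ s ≤ γ ^ 2) ∧
      ∀ s ∈ Ioo 0 b, τ2 s + τ1 s / s = (1 - τ s / γ ^ 2) *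
        (lam * (μ * γ) ^ 2 + 4 * (exp (τ s ^ 2 / γ ^ 2) * exp (-2 * τ s))) := by
  obtain ⟨u1, u2, hud, hu0, huode, huanti⟩ := h.exists_hasTwoDerivs hlam hβ
  have hmem : ∀ s ∈ Icc 0 b, μ * s ∈ Icc (0 : ℝ) 1 := fun s hs =>
    ⟨mul_nonneg hμ.le hs.1, (mul_le_mul_of_nonneg_left hs.2 hμ.le).trans hμb⟩
  subst hτ
  refine ⟨_, _, ((hud.comp_mul hμ.le hμb).const_sub γ).const_mul γ, by simp [hu0],
    fun s hs => ?_, fun s hs => ?_⟩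
  · have h1 := h.nonneg (hmem s hs)
    have h2 := huanti ⟨le_rfl, zero_le_one⟩ (hmem s hs) (hmem s hs).1
    rw [h.2.2.2.2] at h2
    constructor <;> nlinarith
  · have hs' : μ * s ∈ Ioo (0 : ℝ) 1 :=
      ⟨mul_pos hμ hs.1, (mul_lt_mul_of_pos_left hs.2 hμ).trans_le hμb⟩
    have hode := huode _ hs'
    have hsne := hs.1.ne'
    beta_reduce
    generalize u (μ * s) = U at *
    have e1 : γ * -(μ * (μ * u2 (μ * s))) + γ * -(μ * u1 (μ * s)) / s
        = -(γ * μ ^ 2) * (u2 (μ * s) + u1 (μ * s) / (μ * s)) := by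
      field_simp
      ring
    have e2 : 1 - γ * (γ - U) / γ ^ 2 = U / γ := by field_simp; ring
    have e3 : exp ((γ * (γ - U)) ^ 2 / γ ^ 2) * exp (-2 * (γ * (γ - U)))
        = exp (U ^ 2) / exp (γ ^ 2) := by
      rw [← exp_add, ← exp_sub]
      congr 1
      field_simp
      ring
    rw [e1, e2, e3, hode, ← hμγ]
    field_simp

/-- The error made on replacing the rescaled nonlinearity by its limit `4 exp (-2 t)`. -/
lemma abs_rescaled_nonlinearity_sub_le {a γ B t T : ℝ} (ha : 0 ≤ a) (hγ : 0 < γ) (ht : 0 ≤ t)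
    (htB : t ≤ B) (htγ : t ≤ γ ^ 2) (hT : 0 ≤ T) :
    |(1 - t / γ ^ 2) * (a + 4 * (exp (t ^ 2 / γ ^ 2) * exp (-2 * t))) - 4 * exp (-2 * T)|
      ≤ a + 4 * (exp (B ^ 2 / γ ^ 2) - 1 + B / γ ^ 2) + 8 * |t - T| := by
  have hx0 : 0 ≤ t / γ ^ 2 := by positivity
  have hx1 : t / γ ^ 2 ≤ 1 := by rw [div_le_one (by positivity)]; exact htγ
  have hxB : t / γ ^ 2 ≤ B / γ ^ 2 := by gcongr
  have hyB : exp (t ^ 2 / γ ^ 2) ≤ exp (B ^ 2 / γ ^ 2) := by gcongr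
  have hy1 : 1 ≤ exp (t ^ 2 / γ ^ 2) := one_le_exp (by positivity)
  have hz0 : 0 < exp (-2 * t) := exp_pos _
  have hz1 : exp (-2 * t) ≤ 1 := exp_le_one_iff.2 (by linarith)
  have hlip : |exp (-2 * t) - exp (-2 * T)| ≤ 2 * |t - T| := by
    have key : ∀ p q : ℝ, 0 ≤ p → p ≤ q → exp (-2 * p) - exp (-2 * q) ≤ 2 * (q - p) := by
      intro p q hp hpq
      have h1 : exp (-2 * q) = exp (-2 * p) * exp (-2 * (q - p)) := by
        rw [← exp_add]; congr 1; ring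
      have h2 := add_one_le_exp (-2 * (q - p))
      have h3 : exp (-2 * p) ≤ 1 := exp_le_one_iff.2 (by linarith)
      have h4 := exp_pos (-2 * p)
      rw [h1]
      nlinarith
    rcases le_total t T with h | h
    · have h1 : exp (-2 * T) ≤ exp (-2 * t) := exp_le_exp.2 (by linarith)
      rw [abs_of_nonneg (by linarith), abs_of_nonpos (by linarith)]
      linarith [key t T ht h]
    · have h1 : exp (-2 * t) ≤ exp (-2 * T) := exp_le_exp.2 (by linarith)
      rw [abs_of_nonpos (by linarith), abs_of_nonneg (by linarith)]
      linarith [key T t hT h]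
  generalize exp (t ^ 2 / γ ^ 2) = y at *
  generalize exp (B ^ 2 / γ ^ 2) = Y at *
  generalize t / γ ^ 2 = x at *
  generalize B / γ ^ 2 = X at *
  generalize exp (-2 * t) = z at *
  generalize exp (-2 * T) = Z at *
  have hmid : |((1 - x) * y - 1) * z| ≤ Y - 1 + X := by
    have h1 : |(1 - x) * y - 1| ≤ Y - 1 + X := by rw [abs_le]; constructor <;> nlinarith
    rw [abs_mul, abs_of_pos hz0]
    nlinarith [abs_nonneg ((1 - x) * y - 1)]
  have hfst : |(1 - x) * a| ≤ a := by
    rw [abs_of_nonneg (mul_nonneg (by linarith) ha)]; nlinarith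
  have e : (1 - x) * (a + 4 * (y * z)) - 4 * Z
      = (1 - x) * a + 4 * (((1 - x) * y - 1) * z) + 4 * (z - Z) := by ring
  rw [e]
  refine (abs_add_three _ _ _).trans ?_
  rw [abs_mul 4, abs_mul 4, abs_of_pos (four_pos : (0 : ℝ) < 4)]
  linarith

/-- Quantitative closeness of the rescaled solution to `log (1 + |y| ^ 2)`. -/
lemma IsRadSol.iteratedDerivWithin_rescaled_sub_le {lam β γ μ b : ℝ} {u : ℝ → ℝ}
    (hlam : 0 ≤ lam) (hβ : 0 ≤ β) (hγ : 0 < γ) (hμ : 0 < μ)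
    (hμγ : β * γ ^ 2 * exp (γ ^ 2) * μ ^ 2 = 4) (hb : 0 < b) (hμb : μ * b ≤ 1)
    (ha : lam * (μ * γ) ^ 2 ≤ 1) (h : IsRadSol lam β γ u) {k : ℕ} (hk : k ≤ 2) {s : ℝ}
    (hs : s ∈ Ico 0 b) :
    |iteratedDerivWithin k (fun t => γ * (γ - u (μ * t))) (Ici 0) s
        - iteratedDerivWithin k (fun s => log (1 + s ^ 2)) (Ici 0) s|
      ≤ 2 * (1 + 8 * exp ((2 + 8) * b)) *
        (lam * (μ * γ) ^ 2 + 4 * (exp ((5 / 4 * b ^ 2) ^ 2 / γ ^ 2) - 1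
          + 5 / 4 * b ^ 2 / γ ^ 2)) := by
  obtain ⟨τ, hτ⟩ : ∃ τ : ℝ → ℝ, τ = fun t => γ * (γ - u (μ * t)) := ⟨_, rfl⟩
  obtain ⟨τ1, τ2, hd, h0, hbd, hode⟩ :=
    h.exists_hasTwoDerivs_rescaled hlam hβ hγ hμ hμγ hμb hτ
  have hann : 0 ≤ lam * (μ * γ) ^ 2 := by positivity
  rw [← hτ]
  generalize lam * (μ * γ) ^ 2 = a at *
  have hτ0 : τ 0 = 0 := by rw [hτ]; simp [h.2.2.2.2]
  have hτB : ∀ s ∈ Icc 0 b, τ s ≤ 5 / 4 * b ^ 2 := fun s hs => by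
    have h1 := hd.le_of_fst_le (c := 5) (fun t ht => hd.fst_le h0 (fun r hr => by
      obtain ⟨h2, h3⟩ := hbd r (Ioo_subset_Icc_self hr)
      rw [hode r hr, ← exp_add]
      have h4 : exp (τ r ^ 2 / γ ^ 2 + -2 * τ r) ≤ 1 := by
        rw [exp_le_one_iff]
        have : τ r ^ 2 / γ ^ 2 ≤ τ r := by rw [div_le_iff₀ (by positivity)]; nlinarith
        linarith
      have h5 : 0 ≤ τ r / γ ^ 2 := by positivity
      have h6 := exp_pos (τ r ^ 2 / γ ^ 2 + -2 * τ r)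
      nlinarith) ht) hs
    rw [hτ0] at h1
    nlinarith [hs.1, hs.2]
  have hT := hasTwoDerivs_log_one_add_sq b
  obtain ⟨η, hη⟩ : ∃ η, η = a + 4 * (exp ((5 / 4 * b ^ 2) ^ 2 / γ ^ 2) - 1
      + 5 / 4 * b ^ 2 / γ ^ 2) := ⟨_, rfl⟩
  have hηnn : 0 ≤ η := by
    have h1 : 1 ≤ exp ((5 / 4 * b ^ 2) ^ 2 / γ ^ 2) := one_le_exp (by positivity)
    have h2 : 0 ≤ 5 / 4 * b ^ 2 / γ ^ 2 := by positivity
    rw [hη]; linarith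
  obtain ⟨g0, g1, g2⟩ := (hd.sub hT).gronwall hb (by simp [hτ0]) (by simp [h0])
    (L := 8) (η := η) (by norm_num) hηnn (fun r hr => by
      obtain ⟨h2, h3⟩ := hbd r (Ioo_subset_Icc_self hr)
      have e : ∀ p q p' q' : ℝ, p - q + (p' - q') / r = p + p' / r - (q + q' / r) := by
        intros; ring
      rw [e, hode r hr, liouville_log_one_add_sq hr.1.ne', hη]
      exact abs_rescaled_nonlinearity_sub_le hann hγ h2 (hτB r (Ioo_subset_Icc_self hr)) h3
        (log_nonneg (by nlinarith))) (Ico_subset_Icc_self hs)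
  rw [← hη]
  have hle : exp ((2 + 8) * b) * η ≤ 2 * (1 + 8 * exp ((2 + 8) * b)) * η :=
    mul_le_mul_of_nonneg_right (by linarith [exp_pos ((2 + 8) * b)]) hηnn
  interval_cases k
  · simpa only [iteratedDerivWithin_zero] using g0.trans hle
  · rw [(hd.iteratedDerivWithin_Ici hs).1, (hT.iteratedDerivWithin_Ici hs).1]
    exact g1.trans hle
  · rw [(hd.iteratedDerivWithin_Ici hs).2, (hT.iteratedDerivWithin_Ici hs).2]
    exact g2

/-- With μ_γ > 0 defined by β_γ γ² e^{γ²} μ_γ² = 4, we have μ_γ γ → 0,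
and τ_γ(y) := γ(γ − u_γ(μ_γ y)) converges to T₀(y) = log(1+|y|²) in C²_loc(ℝ²):
radially, all derivatives of order ≤ 2 converge uniformly on every compact [0,R]. -/
theorem statement7 (lam1 : ℝ) (v1 : ℝ → ℝ) (hE : EigenCtx lam1 v1) (l : ℝ) (hl : 0 < l)
    (β : ℝ → ℝ) (u : ℝ → ℝ → ℝ) (hF : GoodFamily lam1 v1 l β u)
    (μ : ℝ → ℝ)
    (hμ : ∀ γ : ℝ, 0 < γ → 0 < lamBar lam1 (v1 0) l γ →
      0 < μ γ ∧ β γ * γ ^ 2 * Real.exp (γ ^ 2) * (μ γ) ^ 2 = 4) :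
    Tendsto (fun γ : ℝ => μ γ * γ) atTop (𝓝 0) ∧
    ∀ R : ℝ, 0 < R → ∀ k : ℕ, k ≤ 2 →
      TendstoUniformlyOn
        (fun (γ : ℝ) (s : ℝ) =>
          iteratedDerivWithin k (fun t => γ * (γ - u γ (μ γ * t))) (Set.Ici 0) s)
        (iteratedDerivWithin k (fun s => Real.log (1 + s ^ 2)) (Set.Ici 0))
        atTop (Set.Icc 0 R) := by
  have hlam1 := hE.1
  have hlamev : ∀ᶠ γ in atTop, 0 < lamBar lam1 (v1 0) l γ :=
    (tendsto_lamBar lam1 (v1 0) l).eventually (lt_mem_nhds hlam1)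
  have hsq : Tendsto (fun γ => (μ γ * γ) ^ 2) atTop (𝓝 0) := by
    refine ((tendsto_const_nhds (x := (4 : ℝ))).div_atTop
      (hF.tendsto_beta_mul_exp hE hl)).congr' ?_
    filter_upwards [eventually_gt_atTop 0, hlamev] with γ hγ hlam
    have hβ := (hF γ hγ hlam).1
    rw [← (hμ γ hγ hlam).2]
    field_simp
  have hμγ : Tendsto (fun γ => μ γ * γ) atTop (𝓝 0) := by
    rw [tendsto_zero_iff_abs_tendsto_zero]
    have h := hsq.sqrt
    simp only [sqrt_sq_eq_abs, sqrt_zero] at h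
    exact h
  refine ⟨hμγ, fun R hR k hk => ?_⟩
  set b := R + 1 with hb
  have hbpos : 0 < b := by positivity
  have ha : Tendsto (fun γ => lamBar lam1 (v1 0) l γ * (μ γ * γ) ^ 2) atTop (𝓝 0) := by
    simpa using (tendsto_lamBar lam1 (v1 0) l).mul hsq
  have hdiv : ∀ c : ℝ, Tendsto (fun γ : ℝ => c / γ ^ 2) atTop (𝓝 0) := fun c =>
    tendsto_const_nhds.div_atTop (tendsto_pow_atTop two_ne_zero)
  have hbound : Tendsto (fun γ => 2 * (1 + 8 * exp ((2 + 8) * b)) *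
      (lamBar lam1 (v1 0) l γ * (μ γ * γ) ^ 2 + 4 * (exp ((5 / 4 * b ^ 2) ^ 2 / γ ^ 2) - 1
        + 5 / 4 * b ^ 2 / γ ^ 2))) atTop (𝓝 0) := by
    have h := (ha.add ((((hdiv ((5 / 4 * b ^ 2) ^ 2)).rexp.sub_const 1).add
      (hdiv (5 / 4 * b ^ 2))).const_mul 4)).const_mul (2 * (1 + 8 * exp ((2 + 8) * b)))
    simpa using h
  rw [Metric.tendstoUniformlyOn_iff]
  intro ε hε
  filter_upwards [eventually_ge_atTop 1, hlamev, ha.eventually (gt_mem_nhds one_pos),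
    hμγ.eventually (gt_mem_nhds (one_div_pos.2 hbpos)), hbound.eventually (gt_mem_nhds hε)]
    with γ hγ hlam h1 h2 h3 s hs
  have hγpos : 0 < γ := by linarith
  obtain ⟨hβ, hu⟩ := hF γ hγpos hlam
  obtain ⟨hμpos, hμeq⟩ := hμ γ hγpos hlam
  have hμb : μ γ * b ≤ 1 := by
    rw [lt_div_iff₀ hbpos] at h2
    nlinarith [mul_pos hμpos hbpos]
  rw [dist_comm, Real.dist_eq]
  exact (hu.iteratedDerivWithin_rescaled_sub_le hlam.le hβ.le hγpos hμpos hμeq hbpos hμb h1.le hk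
    ⟨hs.1, by linarith [hs.2]⟩).trans_lt h3


end
end
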